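/- The map phi -> phi(f_{0,1}) is an isomorphism of Fpbar-vector spaces from Hom_G(ind_K^G 1, ind_K^G st) onto the space of K-invariants (ind_K^G st)^K, and the set {f_{n,st} + f_{-n,st} : n >= 1} is a basis of (ind_K^G st)^K; consequently Hom_G(ind_K^G 1, ind_K^G st) is isomorphic to the span of {f_{n,st} + f_{-n,st} : n >= 1}. -/

import Mathlib

open scoped Classical

noncomputable section

namespace U21

/-- The arithmetic setting: `E` is the unramified quadratic extension of a non-archimedean
local field `F` of odd residue characteristic `p`, with residue field of `F` of cardinality
`q = p ^ fdeg`.  The field `E` is encoded through its valuation subring `O = o_E`, a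
uniformizer `ϖ`, the maximal ideal `mI` (so that `p_E^k` is `ϖ ^ k * O`), and the nontrivial
`F`-automorphism `conj` of `E` (which induces the `q`-power Frobenius on the residue field
of `E`, of cardinality `q ^ 2`). -/
structure Setting where
  p : ℕ
  q : ℕ
  fdeg : ℕ
  hp : p.Prime
  hodd : p ≠ 2
  hfdeg : 0 < fdeg
  hq : q = p ^ fdeg
  E : Type
  [fieldE : Field E]
  conj : E →+* E
  conj_invol : ∀ x, conj (conj x) = x
  conj_ne : conj ≠ RingHom.id E
  O : Subring E
  val_ring : ∀ x : E, x ≠ 0 → x ∈ O ∨ x⁻¹ ∈ O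
  conj_O : ∀ x, x ∈ O → conj x ∈ O
  ϖ : E
  unif_mem : ϖ ∈ O
  unif_ne : ϖ ≠ 0
  unif_conj : conj ϖ = ϖ
  unif_not_unit : ¬ IsUnit (⟨ϖ, unif_mem⟩ : O)
  disc : ∀ x : E, x ≠ 0 → ∃ (n : ℤ) (u : Oˣ), x = (u : O) * ϖ ^ n
  mI : Ideal O
  hmI : ∀ x : O, x ∈ mI ↔ ∃ y ∈ O, (x : E) = ϖ * y
  [fin_res : Fintype (O ⧸ mI)]
  card_res : Fintype.card (O ⧸ mI) = q ^ 2
  res_frob : ∀ x : O, Ideal.Quotient.mk mI ⟨conj x, conj_O x x.2⟩ = (Ideal.Quotient.mk mI x) ^ q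
  complete : ∀ a : ℕ → E,
    (∀ k : ℕ, ∃ N, ∀ m ≥ N, ∀ n ≥ N, ∃ w ∈ O, a m - a n = ϖ ^ k * w) →
    ∃ L : E, ∀ k : ℕ, ∃ N, ∀ n ≥ N, ∃ w ∈ O, a n - L = ϖ ^ k * w

attribute [instance] Setting.fieldE Setting.fin_res

namespace Setting

variable (S : Setting)

/-- 3×3 matrices over `E`. -/
abbrev M3 := Matrix (Fin 3) (Fin 3) S.E

/-- The antidiagonal matrix `β` of the Hermitian form. -/
def betaM : S.M3 := !![0,0,1;0,1,0;1,0,0]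

/-- The fractional ideal `p_E ^ k ⊆ E` (for `k : ℤ`). -/
def pE (k : ℤ) : Set S.E := {z | ∃ w ∈ S.O, z = S.ϖ ^ k * w}

/-- The unramified unitary group `G = U(2,1)(E/F)`, as a subgroup of `GL₃(E)`:
`g ∈ G` iff `g.transpose * β * conj g = β`. -/
def Gsub : Subgroup (Matrix.GeneralLinearGroup (Fin 3) S.E) where
  carrier := {g | ((g : S.M3)).transpose * S.betaM * ((g : S.M3).map S.conj) = S.betaM}
  one_mem' := by
    simp [Matrix.map_one (⇑S.conj) (map_zero S.conj) (map_one S.conj)]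
  mul_mem' := by
    intro a b ha hb
    simp only [Set.mem_setOf_eq, Units.val_mul, Matrix.transpose_mul, Matrix.map_mul] at ha hb ⊢
    calc ((b : S.M3)).transpose * ((a : S.M3)).transpose * S.betaM * ((a : S.M3).map S.conj * (b : S.M3).map S.conj)
        = ((b : S.M3)).transpose * (((a : S.M3)).transpose * S.betaM * (a : S.M3).map S.conj) * ((b : S.M3).map S.conj) := by
          simp only [mul_assoc]
      _ = S.betaM := by rw [ha]; exact hb
  inv_mem' := by
    intro a ha
    simp only [Set.mem_setOf_eq] at ha ⊢
    have hA : IsUnit ((a : S.M3)) := a.isUnit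
    have hdet : IsUnit ((a : S.M3)).det := (Matrix.isUnit_iff_isUnit_det _).mp hA
    have hAc : IsUnit (((a : S.M3)).map ⇑S.conj) := by
      rw [← RingHom.mapMatrix_apply]; exact hA.map _
    have hdetc : IsUnit ((((a : S.M3)).map ⇑S.conj).det) := (Matrix.isUnit_iff_isUnit_det _).mp hAc
    have hdetT : IsUnit ((((a : S.M3)).transpose).det) := by rw [Matrix.det_transpose]; exact hdet
    have hmapinv : ((a : S.M3)⁻¹).map ⇑S.conj = (((a : S.M3)).map ⇑S.conj)⁻¹ := by
      symm
      apply Matrix.inv_eq_left_inv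
      rw [← Matrix.map_mul, Matrix.nonsing_inv_mul _ hdet,
        Matrix.map_one (⇑S.conj) (map_zero S.conj) (map_one S.conj)]
    rw [Matrix.coe_units_inv, Matrix.transpose_nonsing_inv, hmapinv]
    conv_lhs => rw [← ha]
    calc (((a:S.M3)).transpose)⁻¹ * (((a:S.M3)).transpose * S.betaM * ((a:S.M3)).map ⇑S.conj) * (((a:S.M3)).map ⇑S.conj)⁻¹
        = (((a:S.M3)).transpose)⁻¹ * ((a:S.M3)).transpose * S.betaM *
            (((a:S.M3)).map ⇑S.conj * (((a:S.M3)).map ⇑S.conj)⁻¹) := by simp only [mul_assoc]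
      _ = S.betaM := by
          rw [Matrix.nonsing_inv_mul _ hdetT, Matrix.mul_nonsing_inv _ hdetc, one_mul, mul_one]

/-- The group `G = U(2,1)(E/F)`. -/
abbrev GG := ↥S.Gsub

/-- The matrix of an element of `G`. -/
def mat (g : S.GG) : S.M3 := ((g : Matrix.GeneralLinearGroup (Fin 3) S.E) : S.M3)

/-- The upper unipotent matrix `n(x,y)`. -/
def nM (x y : S.E) : S.M3 := !![1, x, y; 0, 1, -S.conj x; 0, 0, 1]

/-- The lower unipotent matrix `n'(x,y)`. -/
def n'M (x y : S.E) : S.M3 := !![1, 0, 0; x, 1, 0; y, -S.conj x, 1]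

/-- The diagonal matrix `h(x) = diag(x, -x̄x⁻¹, x̄⁻¹)`. -/
def hM (x : S.E) : S.M3 := !![x, 0, 0; 0, -S.conj x * x⁻¹, 0; 0, 0, (S.conj x)⁻¹]

/-- The subgroup `N` of `G` (unipotent radical of the upper triangular Borel), as a set. -/
def Nset : Set S.GG := {g | ∃ x y : S.E, x * S.conj x + y + S.conj y = 0 ∧ S.mat g = S.nM x y}

/-- The subgroup `N_k = {n(x,y) : y ∈ p_E^k}`, as a set. -/
def Nk (k : ℤ) : Set S.GG :=
  {g | ∃ x y : S.E, x * S.conj x + y + S.conj y = 0 ∧ y ∈ S.pE k ∧ S.mat g = S.nM x y}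

/-- The subgroup `N'` of `G`, as a set. -/
def N'set : Set S.GG := {g | ∃ x y : S.E, x * S.conj x + y + S.conj y = 0 ∧ S.mat g = S.n'M x y}

/-- The subgroup `N'_k = {n'(x,y) : y ∈ p_E^k}`, as a set. -/
def N'k (k : ℤ) : Set S.GG :=
  {g | ∃ x y : S.E, x * S.conj x + y + S.conj y = 0 ∧ y ∈ S.pE k ∧ S.mat g = S.n'M x y}

/-- The diagonal subgroup `H` of `G`, as a set. -/
def Hset : Set S.GG := {g | ∃ a b c : S.E, S.mat g = !![a,0,0;0,b,0;0,0,c]}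

/-- The hyperspecial maximal compact subgroup `K₀ = G ∩ GL₃(o_E)`, as a set. -/
def K0set : Set S.GG := {g | ∀ i j, S.mat g i j ∈ S.O}

/-- The special (non-hyperspecial) maximal compact subgroup `K₁`, as a set. -/
def K1set : Set S.GG :=
  {g | S.mat g 0 0 ∈ S.O ∧ S.mat g 0 1 ∈ S.O ∧ S.mat g 0 2 ∈ S.pE (-1) ∧
       S.mat g 1 0 ∈ S.pE 1 ∧ S.mat g 1 1 ∈ S.O ∧ S.mat g 1 2 ∈ S.O ∧
       S.mat g 2 0 ∈ S.pE 1 ∧ S.mat g 2 1 ∈ S.pE 1 ∧ S.mat g 2 2 ∈ S.O}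

/-- The Iwahori subgroup `I_{K₀}` (preimage of the Borel of `Γ_{K₀}`), as a set. -/
def IK0 : Set S.GG :=
  {g | g ∈ S.K0set ∧ S.mat g 1 0 ∈ S.pE 1 ∧ S.mat g 2 0 ∈ S.pE 1 ∧ S.mat g 2 1 ∈ S.pE 1}

/-- The pro-p Iwahori subgroup `I_{1,K₀}`, as a set. -/
def I1K0 : Set S.GG :=
  {g | g ∈ S.IK0 ∧ S.mat g 0 0 - 1 ∈ S.pE 1 ∧ S.mat g 1 1 - 1 ∈ S.pE 1 ∧ S.mat g 2 2 - 1 ∈ S.pE 1}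

/-- The opposite pro-p Iwahori subgroup `I'_{1,K₀}`, as a set. -/
def I1'K0 : Set S.GG :=
  {g | g ∈ S.K0set ∧ S.mat g 0 1 ∈ S.pE 1 ∧ S.mat g 0 2 ∈ S.pE 1 ∧ S.mat g 1 2 ∈ S.pE 1 ∧
       S.mat g 0 0 - 1 ∈ S.pE 1 ∧ S.mat g 1 1 - 1 ∈ S.pE 1 ∧ S.mat g 2 2 - 1 ∈ S.pE 1}

/-- The maximal normal pro-p subgroup `K₀¹` of `K₀` (principal congruence subgroup), as a set. -/
def Kone0 : Set S.GG := {g | ∀ i j, S.mat g i j - (1 : S.M3) i j ∈ S.pE 1}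

/-- The Iwahori subgroup `I_{K₁}`, as a set. -/
def IK1 : Set S.GG := {g | g ∈ S.K1set ∧ S.mat g 2 0 ∈ S.pE 2}

/-- The pro-p Iwahori subgroup `I_{1,K₁}`, as a set. -/
def I1K1 : Set S.GG :=
  {g | g ∈ S.IK1 ∧ S.mat g 0 0 - 1 ∈ S.pE 1 ∧ S.mat g 1 1 - 1 ∈ S.pE 1 ∧ S.mat g 2 2 - 1 ∈ S.pE 1}

/-- The opposite pro-p Iwahori subgroup `I'_{1,K₁}`, as a set. -/
def I1'K1 : Set S.GG :=
  {g | g ∈ S.K1set ∧ S.mat g 0 2 ∈ S.O ∧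
       S.mat g 0 0 - 1 ∈ S.pE 1 ∧ S.mat g 1 1 - 1 ∈ S.pE 1 ∧ S.mat g 2 2 - 1 ∈ S.pE 1}

/-- The maximal normal pro-p subgroup `K₁¹` of `K₁`, as a set. -/
def Kone1 : Set S.GG :=
  {g | g ∈ S.K1set ∧ S.mat g 0 2 ∈ S.O ∧ S.mat g 2 0 ∈ S.pE 2 ∧
       S.mat g 0 0 - 1 ∈ S.pE 1 ∧ S.mat g 1 1 - 1 ∈ S.pE 1 ∧ S.mat g 2 2 - 1 ∈ S.pE 1}

/-- The congruence subgroup of level `n` (used to express smoothness), as a set. -/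
def cong (n : ℕ) : Set S.GG := {g | ∀ i j, S.mat g i j - (1 : S.M3) i j ∈ S.pE n}

def alphaM : S.M3 := !![S.ϖ⁻¹, 0, 0; 0, 1, 0; 0, 0, S.ϖ]

def alphaMinv : S.M3 := !![S.ϖ, 0, 0; 0, 1, 0; 0, 0, S.ϖ⁻¹]

lemma alpha_mul_inv : S.alphaM * S.alphaMinv = 1 := by
  ext i j
  fin_cases i <;> fin_cases j <;>
    simp [alphaM, alphaMinv, Matrix.mul_apply, Fin.sum_univ_three, Matrix.one_apply,
      Matrix.vecHead, Matrix.vecTail, inv_mul_cancel₀ S.unif_ne, mul_inv_cancel₀ S.unif_ne]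

lemma alpha_inv_mul : S.alphaMinv * S.alphaM = 1 := by
  ext i j
  fin_cases i <;> fin_cases j <;>
    simp [alphaM, alphaMinv, Matrix.mul_apply, Fin.sum_univ_three, Matrix.one_apply,
      Matrix.vecHead, Matrix.vecTail, inv_mul_cancel₀ S.unif_ne, mul_inv_cancel₀ S.unif_ne]

def alphaU : Matrix.GeneralLinearGroup (Fin 3) S.E :=
  ⟨S.alphaM, S.alphaMinv, S.alpha_mul_inv, S.alpha_inv_mul⟩

lemma alphaU_mem : S.alphaU ∈ S.Gsub := by
  show ((S.alphaU : S.M3)).transpose * S.betaM * ((S.alphaU : S.M3).map S.conj) = S.betaM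
  have : (S.alphaU : S.M3) = S.alphaM := rfl
  rw [this]
  ext i j
  fin_cases i <;> fin_cases j <;>
    simp [alphaM, betaM, Matrix.mul_apply, Fin.sum_univ_three, Matrix.map_apply,
      Matrix.transpose_apply, Matrix.vecHead, Matrix.vecTail, map_inv₀, S.unif_conj,
      inv_mul_cancel₀ S.unif_ne, mul_inv_cancel₀ S.unif_ne]

/-- The element `α = diag(ϖ⁻¹, 1, ϖ)` of `G`. -/
def alphaE : S.GG := ⟨S.alphaU, S.alphaU_mem⟩

lemma beta_mul_beta : S.betaM * S.betaM = 1 := by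
  ext i j
  fin_cases i <;> fin_cases j <;>
    simp [betaM, Matrix.mul_apply, Fin.sum_univ_three, Matrix.one_apply,
      Matrix.vecHead, Matrix.vecTail]

def betaU : Matrix.GeneralLinearGroup (Fin 3) S.E :=
  ⟨S.betaM, S.betaM, S.beta_mul_beta, S.beta_mul_beta⟩

lemma betaU_mem : S.betaU ∈ S.Gsub := by
  show ((S.betaU : S.M3)).transpose * S.betaM * ((S.betaU : S.M3).map S.conj) = S.betaM
  have : (S.betaU : S.M3) = S.betaM := rfl
  rw [this]
  ext i j
  fin_cases i <;> fin_cases j <;>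
    simp [betaM, Matrix.mul_apply, Fin.sum_univ_three, Matrix.map_apply, Matrix.transpose_apply,
      Matrix.vecHead, Matrix.vecTail]

/-- The element `β` of `G`. -/
def betaE : S.GG := ⟨S.betaU, S.betaU_mem⟩

/-- The element `β' = β * α⁻¹` of `G`. -/
def betaPr : S.GG := S.betaE * S.alphaE⁻¹

/-- A finite set `U` is a set of representatives for the cosets `A/B`. -/
def IsReps (A B : Set S.GG) (U : Finset S.GG) : Prop :=
  (↑U : Set S.GG) ⊆ A ∧ ∀ a ∈ A, ∃! u, u ∈ U ∧ a⁻¹ * u ∈ B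

/-- The residue field `k_E` of `E`. -/
abbrev kE := S.O ⧸ S.mI

/-- The residue map `o_E → k_E`. -/
def resmap : S.O →+* S.kE := Ideal.Quotient.mk S.mI

/-- The group `L_{q³} = {(x,t) ∈ k_E² : x x̄ + t + t̄ = 0}` (where `x̄ = x^q`). -/
def Lbig : Set (S.kE × S.kE) := {z | z.1 * z.1 ^ S.q + z.2 + z.2 ^ S.q = 0}

/-- The group `L_q = {(0,t) ∈ k_E² : t + t̄ = 0}`. -/
def Lsmall : Set (S.kE × S.kE) := {z | z.1 = 0 ∧ z.2 + z.2 ^ S.q = 0}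

/-- `L_{q^t}` for `t ∈ {1,3}`. -/
def Lof (t : ℕ) : Set (S.kE × S.kE) := if t = 3 then S.Lbig else S.Lsmall

end Setting

/-- A choice of one of the two maximal compact open subgroups `K ∈ {K₀, K₁}` of `G`,
together with its maximal normal pro-p subgroup `K¹`, the (pro-p) Iwahori subgroups
`I_K ⊇ I_{1,K}`, the opposite pro-p Iwahori `I'_{1,K}`, the element
`β_K ∈ K ∩ {β, β'}`, and the integers `n_K, m_K, t_K`. -/
structure Chamber (S : Setting) where
  K : Subgroup S.GG
  KoneS : Set S.GG
  IK : Set S.GG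
  I1 : Set S.GG
  I1' : Set S.GG
  βK : S.GG
  nK : ℤ
  mK : ℤ
  tK : ℕ
  cases :
    ((K : Set S.GG) = S.K0set ∧ KoneS = S.Kone0 ∧ IK = S.IK0 ∧ I1 = S.I1K0 ∧ I1' = S.I1'K0 ∧
      βK = S.betaE ∧ nK = 0 ∧ mK = 1 ∧ tK = 3) ∨
    ((K : Set S.GG) = S.K1set ∧ KoneS = S.Kone1 ∧ IK = S.IK1 ∧ I1 = S.I1K1 ∧ I1' = S.I1'K1 ∧
      βK = S.betaPr ∧ nK = -1 ∧ mK = 2 ∧ tK = 1)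

namespace Chamber

variable {S : Setting} (C : Chamber S)

/-- `H₀ = H ∩ I_K`. -/
def H0 : Set S.GG := S.Hset ∩ C.IK

/-- `H₁ = H ∩ I_{1,K}`. -/
def H1 : Set S.GG := S.Hset ∩ C.I1

end Chamber

section RepTheory

variable {S : Setting} (C : Chamber S)
variable (𝔽 : Type) [Field 𝔽]

section Generic

variable {G₀ : Type} [Monoid G₀] {V : Type} [AddCommGroup V] [Module 𝔽 V]

/-- A submodule is invariant under a representation. -/
def Invt (ρ : Representation 𝔽 G₀ V) (Ssub : Submodule 𝔽 V) : Prop :=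
  ∀ g v, v ∈ Ssub → ρ g v ∈ Ssub

/-- The subrepresentation generated by a vector (the span of its orbit). -/
def orbitSpan (ρ : Representation 𝔽 G₀ V) (v : V) : Submodule 𝔽 V :=
  Submodule.span 𝔽 {w | ∃ g, w = ρ g v}

/-- The subrepresentation generated by a vector under a subset `A` of the group. -/
def orbitSpanOn (ρ : Representation 𝔽 G₀ V) (A : Set G₀) (v : V) : Submodule 𝔽 V :=
  Submodule.span 𝔽 {w | ∃ g ∈ A, w = ρ g v}

/-- The quotient of a representation by an invariant submodule `N` is irreducible:
equivalently (by the lattice correspondence), `N ≠ ⊤` and any invariant submodule lying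
between `N` and `⊤` equals `N` or `⊤`. -/
def QuotientIrreducible (ρ : Representation 𝔽 G₀ V) (N : Submodule 𝔽 V) : Prop :=
  N ≠ ⊤ ∧ ∀ Ssub : Submodule 𝔽 V, Invt 𝔽 ρ Ssub → N ≤ Ssub → Ssub = N ∨ Ssub = ⊤

/-- The submodule of vectors invariant under all elements of the subset `A`. -/
def invariantsOn (ρ : Representation 𝔽 G₀ V) (A : Set G₀) : Submodule 𝔽 V where
  carrier := {v | ∀ g ∈ A, ρ g v = v}
  add_mem' := by
    intro a b ha hb g hg
    rw [map_add, ha g hg, hb g hg]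
  zero_mem' := by
    intro g hg
    rw [map_zero]
  smul_mem' := by
    intro c a ha g hg
    rw [map_smul, ha g hg]

/-- The space `Hom_G(ρ₁, ρ₂)` of equivariant linear maps, as a submodule of the linear maps. -/
def EquivHomSub {V₂ : Type} [AddCommGroup V₂] [Module 𝔽 V₂]
    (ρ₁ : Representation 𝔽 G₀ V) (ρ₂ : Representation 𝔽 G₀ V₂) :
    Submodule 𝔽 (V →ₗ[𝔽] V₂) where
  carrier := {φ | ∀ g x, φ (ρ₁ g x) = ρ₂ g (φ x)}
  add_mem' := by
    intro a b ha hb g x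
    simp only [LinearMap.add_apply, ha g x, hb g x, map_add]
  zero_mem' := by
    intro g x
    simp only [LinearMap.zero_apply, map_zero]
  smul_mem' := by
    intro c a ha g x
    simp only [LinearMap.smul_apply, ha g x, map_smul]

end Generic

section Weight

variable (W : Type) [AddCommGroup W] [Module 𝔽 W]
variable (σ : Representation 𝔽 ↥C.K W)

/-- Extension of `σ` to all of `G` (by `1` outside `K`); used to avoid coercion issues. -/
def sigma' : S.GG → Module.End 𝔽 W := fun g => if h : g ∈ C.K then σ ⟨g, h⟩ else 1

/-- `σ` is a weight of `K`: an irreducible smooth representation of `K` over `𝔽`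
factoring through `Γ_K = K / K¹` (automatically finite dimensional). -/
def IsWeight : Prop :=
  Nontrivial W ∧ FiniteDimensional 𝔽 W ∧
  (∀ Ssub : Submodule 𝔽 W, (∀ (k : ↥C.K) (w : W), w ∈ Ssub → σ k w ∈ Ssub) → Ssub = ⊥ ∨ Ssub = ⊤) ∧
  (∀ (g : S.GG) (hg : g ∈ C.K), g ∈ C.KoneS → σ ⟨g, hg⟩ = LinearMap.id)

/-- `σ` is one dimensional of the form `χ ∘ det`. -/
def IsDetWeight : Prop :=
  Module.finrank 𝔽 W = 1 ∧
  ∃ c : S.E → 𝔽, ∀ (g : S.GG) (hg : g ∈ C.K) (w : W), σ ⟨g, hg⟩ w = c ((S.mat g).det) • w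

/-- `j_σ : σ → σ` is the composition of the coinvariant projection `σ → σ_{I'_{1,K}}`
with the inverse of the natural isomorphism `σ^{I_{1,K}} ≅ σ_{I'_{1,K}}`:
it restricts to the identity on `σ^{I_{1,K}}` and kills the augmentation part of
`σ` with respect to `I'_{1,K}`. -/
def IsJ (jσ : W →ₗ[𝔽] W) : Prop :=
  (∀ w : W, (∀ g ∈ C.I1, sigma' C 𝔽 W σ g w = w) → jσ w = w) ∧
  (∀ (w : W) (g : S.GG), g ∈ C.I1' → jσ (sigma' C 𝔽 W σ g w - w) = 0)

/-- The defining conditions of the compact induction `ind_K^G σ`: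
`K`-equivariance on the left and compact support (finitely many cosets `K g`). -/
def IndCarrier : Set (S.GG → W) :=
  {f | (∀ (k : S.GG) (hk : k ∈ C.K) (g : S.GG), f (k * g) = σ ⟨k, hk⟩ (f g)) ∧
       ∃ s : Finset S.GG, ∀ g : S.GG, f g ≠ 0 → ∃ k ∈ C.K, ∃ t ∈ s, g = k * t}

/-- The compact induction `ind_K^G σ`, as a submodule of `G → W`. -/
def IndSub : Submodule 𝔽 (S.GG → W) where
  carrier := IndCarrier C 𝔽 W σ
  add_mem' := by
    rintro f g ⟨hf1, sf, hf2⟩ ⟨hg1, sg, hg2⟩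
    refine ⟨fun k hk x => by simp [hf1 k hk x, hg1 k hk x], sf ∪ sg, fun x hx => ?_⟩
    by_cases h : f x ≠ 0
    · obtain ⟨k, hk, t, ht, rfl⟩ := hf2 x h
      exact ⟨k, hk, t, Finset.mem_union_left _ ht, rfl⟩
    · push_neg at h
      have hgx : g x ≠ 0 := by
        intro h0
        apply hx
        simp [Pi.add_apply, h, h0]
      obtain ⟨k, hk, t, ht, rfl⟩ := hg2 x hgx
      exact ⟨k, hk, t, Finset.mem_union_right _ ht, rfl⟩
  zero_mem' := ⟨fun k hk g => by simp, ∅, fun g hg => absurd rfl hg⟩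
  smul_mem' := by
    rintro c f ⟨hf1, sf, hf2⟩
    refine ⟨fun k hk g => by simp [hf1 k hk g], sf, fun x hx => ?_⟩
    refine hf2 x ?_
    intro h0
    apply hx
    simp [h0]

lemma indAct_mem (g : S.GG) {f : S.GG → W} (hf : f ∈ IndCarrier C 𝔽 W σ) :
    (fun x => f (x * g)) ∈ IndCarrier C 𝔽 W σ := by
  obtain ⟨h1, s, h2⟩ := hf
  refine ⟨fun k hk x => ?_, s.image (· * g⁻¹), ?_⟩
  · show f (k * x * g) = _
    rw [mul_assoc]
    exact h1 k hk (x * g)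
  intro x hx
  obtain ⟨k, hk, t, ht, hxg⟩ := h2 (x * g) hx
  refine ⟨k, hk, t * g⁻¹, Finset.mem_image_of_mem _ ht, ?_⟩
  rw [← mul_assoc, ← hxg, mul_assoc, mul_inv_cancel, mul_one]

/-- The representation of `G` on `ind_K^G σ` by right translation. -/
def indRep : Representation 𝔽 S.GG ↥(IndSub C 𝔽 W σ) where
  toFun g :=
    { toFun := fun f => ⟨fun x => (f : S.GG → W) (x * g), indAct_mem C 𝔽 W σ g f.2⟩
      map_add' := fun f1 f2 => Subtype.ext (funext fun x => rfl)
      map_smul' := fun c f => Subtype.ext (funext fun x => rfl) }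
  map_one' := LinearMap.ext fun f => Subtype.ext (funext fun x => by simp [mul_one])
  map_mul' g h := LinearMap.ext fun f => Subtype.ext (funext fun x => by simp [mul_assoc])

/-- The function `[g, v] ∈ ind_K^G σ`: supported on `K g⁻¹`, with value `v` at `g⁻¹`. -/
def stdFn (g : S.GG) (v : W) : S.GG → W :=
  fun x => if h : x * g ∈ C.K then σ ⟨x * g, h⟩ v else 0

/-- The characterization of the family `f_n` (`n ∈ ℤ`) of `I_{1,K}`-invariant elements of
`ind_K^G σ`: `f_n` is supported on `K α⁻ⁿ I_{1,K}` and has value at `α⁻ⁿ` equal to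
`σ(β_K) v₀` for `n > 0` and `v₀` for `n ≤ 0`, where `v₀` is a fixed nonzero vector of
`σ^{I_{1,K}}`. -/
def IsFFamily (v0 : W) (ff : ℤ → ↥(IndSub C 𝔽 W σ)) : Prop :=
  v0 ≠ 0 ∧ (∀ g ∈ C.I1, sigma' C 𝔽 W σ g v0 = v0) ∧
  (∀ (n : ℤ) (g : S.GG), g ∈ C.I1 → indRep C 𝔽 W σ g (ff n) = ff n) ∧
  (∀ (n : ℤ) (x : S.GG), (ff n : S.GG → W) x ≠ 0 →
    ∃ k ∈ C.K, ∃ i ∈ C.I1, x = k * S.alphaE ^ (-n) * i) ∧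
  (∀ n : ℤ, 0 < n → (ff n : S.GG → W) (S.alphaE ^ (-n)) = sigma' C 𝔽 W σ C.βK v0) ∧
  (∀ n : ℤ, n ≤ 0 → (ff n : S.GG → W) (S.alphaE ^ (-n)) = v0)

/-- The characterization of the Hecke operator `T ∈ End_G(ind_K^G σ)`:
it is `G`-equivariant and satisfies
`T [1, v] = ∑_{u ∈ N_{n_K}/N_{n_K+2}} [u α⁻¹, j_σ σ(u⁻¹) v]
  + ∑_{u ∈ N_{n_K+1}/N_{n_K+2}} [β_K u α⁻¹, j_σ σ(β_K) v]`. -/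
def IsHeckeT (jσ : W →ₗ[𝔽] W) (T : Module.End 𝔽 ↥(IndSub C 𝔽 W σ)) : Prop :=
  (∀ (g : S.GG) (x : ↥(IndSub C 𝔽 W σ)),
    T (indRep C 𝔽 W σ g x) = indRep C 𝔽 W σ g (T x)) ∧
  (∀ (v : W) (x : ↥(IndSub C 𝔽 W σ)), (x : S.GG → W) = stdFn C 𝔽 W σ 1 v →
    ∀ (U2 U1 : Finset S.GG),
      S.IsReps (S.Nk C.nK) (S.Nk (C.nK + 2)) U2 →
      S.IsReps (S.Nk (C.nK + 1)) (S.Nk (C.nK + 2)) U1 →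
      ((T x : S.GG → W)) =
        (∑ u ∈ U2, stdFn C 𝔽 W σ (u * S.alphaE⁻¹) (jσ (sigma' C 𝔽 W σ u⁻¹ v))) +
        ∑ u ∈ U1, stdFn C 𝔽 W σ (C.βK * u * S.alphaE⁻¹) (jσ (sigma' C 𝔽 W σ C.βK v)))

/-- The eigencharacter `χ_σ` of `H₀/H₁` afforded by the (one-dimensional) space
`σ^{I_{1,K}}` with chosen basis vector `v₀`. -/
def IsChi (v0 : W) (χ : S.GG → 𝔽) : Prop :=
  (∀ h ∈ C.H0, sigma' C 𝔽 W σ h v0 = χ h • v0)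

/-- Right translation on functions `K → 𝔽` (the action on a (finite) principal series). -/
def PSact (k : ↥C.K) (f : ↥C.K → 𝔽) : ↥C.K → 𝔽 := fun x => f (x * k)

/-- The (inflation to `K` of the) finite principal series `Ind_𝔹^{Γ_K} χ`:
functions on `K`, invariant under right translation by `K¹`, left `I_{1,K}`-invariant and
left `(H₀, χ)`-equivariant. -/
def PSchiSub (χ : S.GG → 𝔽) : Submodule 𝔽 (↥C.K → 𝔽) where
  carrier := {f | (∀ b : ↥C.K, (b : S.GG) ∈ C.I1 → ∀ x, f (b * x) = f x) ∧
                  (∀ h : ↥C.K, (h : S.GG) ∈ C.H0 → ∀ x, f (h * x) = χ (h : S.GG) * f x) ∧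
                  (∀ z : ↥C.K, (z : S.GG) ∈ C.KoneS → ∀ x, f (x * z) = f x)}
  add_mem' := by
    rintro f g ⟨hf1, hf2, hf3⟩ ⟨hg1, hg2, hg3⟩
    exact ⟨fun b hb x => by simp [hf1 b hb x, hg1 b hb x],
           fun h hh x => by simp [hf2 h hh x, hg2 h hh x, mul_add],
           fun z hz x => by simp [hf3 z hz x, hg3 z hz x]⟩
  zero_mem' := ⟨fun b hb x => rfl, fun h hh x => by simp, fun z hz x => rfl⟩
  smul_mem' := by
    rintro c f ⟨hf1, hf2, hf3⟩
    refine ⟨fun b hb x => by simp [hf1 b hb x], fun h hh x => ?_, fun z hz x => by simp [hf3 z hz x]⟩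
    simp only [Pi.smul_apply, hf2 h hh x, smul_eq_mul]
    ring

/-- The principal series `Ind_𝔹^{Γ_K} 1` for the trivial character. -/
def PS1sub : Submodule 𝔽 (↥C.K → 𝔽) := PSchiSub C 𝔽 (fun _ => 1)

/-- `σ_{st}` is the Steinberg weight `st = (Ind_𝔹^{Γ_K} 1)/1`: there is a surjective
`K`-equivariant linear map from `Ind_𝔹^{Γ_K} 1` to it whose kernel is exactly the
constant functions. -/
def IsSteinberg {Wst : Type} [AddCommGroup Wst] [Module 𝔽 Wst]
    (σst : Representation 𝔽 ↥C.K Wst) : Prop :=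
  ∃ φ : ↥(PS1sub C 𝔽) →ₗ[𝔽] Wst, Function.Surjective φ ∧
    (∀ f : ↥(PS1sub C 𝔽), φ f = 0 ↔ ∃ c : 𝔽, (f : ↥C.K → 𝔽) = fun _ => c) ∧
    (∀ (k : ↥C.K) (f f' : ↥(PS1sub C 𝔽)),
      (f' : ↥C.K → 𝔽) = PSact C 𝔽 k (f : ↥C.K → 𝔽) → φ f' = σst k (φ f))

/-- `σ` is isomorphic to a twist of the Steinberg weight by a character. -/
def IsTwistSteinberg : Prop :=
  ∃ (c : ↥C.K →* 𝔽ˣ) (φ : ↥(PS1sub C 𝔽) →ₗ[𝔽] W), Function.Surjective φ ∧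
    (∀ f : ↥(PS1sub C 𝔽), φ f = 0 ↔ ∃ cc : 𝔽, (f : ↥C.K → 𝔽) = fun _ => cc) ∧
    (∀ (k : ↥C.K) (f f' : ↥(PS1sub C 𝔽)),
      (f' : ↥C.K → 𝔽) = PSact C 𝔽 k (f : ↥C.K → 𝔽) →
        φ f' = (c k : 𝔽) • σ k (φ f))


/-- The `K`-subrepresentation of the quotient `(ind_K^G σ) / (range T)` generated by the
image of a vector `v`. -/
def genQuot (T : Module.End 𝔽 ↥(IndSub C 𝔽 W σ)) (v : ↥(IndSub C 𝔽 W σ)) :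
    Submodule 𝔽 (↥(IndSub C 𝔽 W σ) ⧸ LinearMap.range T) :=
  Submodule.span 𝔽 {w | ∃ k ∈ C.K, w = Submodule.Quotient.mk (indRep C 𝔽 W σ k v)}

end Weight

/-- Smoothness of a representation of `G`: every vector is fixed by some congruence
subgroup (equivalently, has open stabilizer). -/
def SmoothRep {V : Type} [AddCommGroup V] [Module 𝔽 V] (ρ : Representation 𝔽 S.GG V) : Prop :=
  ∀ v : V, ∃ n : ℕ, ∀ g ∈ S.cong n, ρ g v = v

end RepTheory

end U21

namespace U21

namespace Setting

variable {S : Setting}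

lemma zpow_unif_ne (n : ℤ) : S.ϖ ^ n ≠ 0 := zpow_ne_zero n S.unif_ne

lemma mem_pE {k : ℤ} {z : S.E} : z ∈ S.pE k ↔ z * S.ϖ ^ (-k) ∈ S.O := by
  constructor
  · rintro ⟨w, hw, rfl⟩
    rwa [mul_right_comm, ← zpow_add₀ S.unif_ne, add_neg_cancel, zpow_zero, one_mul]
  · intro h
    refine ⟨_, h, ?_⟩
    rw [mul_left_comm, ← zpow_add₀ S.unif_ne, add_neg_cancel, zpow_zero, mul_one]

lemma mem_pE_zero {z : S.E} : z ∈ S.pE 0 ↔ z ∈ S.O := by simp [mem_pE]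

lemma zero_mem_pE (k : ℤ) : (0 : S.E) ∈ S.pE k := by simp [mem_pE, S.O.zero_mem]

lemma add_mem_pE {k : ℤ} {x y : S.E} (hx : x ∈ S.pE k) (hy : y ∈ S.pE k) : x + y ∈ S.pE k := by
  rw [mem_pE] at *
  rw [add_mul]
  exact S.O.add_mem hx hy

lemma neg_mem_pE {k : ℤ} {x : S.E} (hx : x ∈ S.pE k) : -x ∈ S.pE k := by
  rw [mem_pE] at *
  rw [neg_mul]
  exact S.O.neg_mem hx

lemma sub_mem_pE {k : ℤ} {x y : S.E} (hx : x ∈ S.pE k) (hy : y ∈ S.pE k) : x - y ∈ S.pE k := by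
  rw [sub_eq_add_neg]
  exact add_mem_pE hx (neg_mem_pE hy)

lemma unif_zpow_mem_O {n : ℤ} (hn : 0 ≤ n) : S.ϖ ^ n ∈ S.O := by
  lift n to ℕ using hn
  rw [zpow_natCast]
  exact S.O.pow_mem S.unif_mem n

lemma pE_anti {k l : ℤ} (h : k ≤ l) {x : S.E} (hx : x ∈ S.pE l) : x ∈ S.pE k := by
  rw [mem_pE] at *
  have : x * S.ϖ ^ (-k) = x * S.ϖ ^ (-l) * S.ϖ ^ (l - k) := by
    rw [mul_assoc, ← zpow_add₀ S.unif_ne]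
    congr 2
    ring
  rw [this]
  exact S.O.mul_mem hx (unif_zpow_mem_O (by omega))

lemma mul_mem_pE {k l : ℤ} {x y : S.E} (hx : x ∈ S.pE k) (hy : y ∈ S.pE l) :
    x * y ∈ S.pE (k + l) := by
  rw [mem_pE] at *
  have : x * y * S.ϖ ^ (-(k + l)) = (x * S.ϖ ^ (-k)) * (y * S.ϖ ^ (-l)) := by
    rw [neg_add, zpow_add₀ S.unif_ne]
    ring
  rw [this]
  exact S.O.mul_mem hx hy

lemma mul_mem_pE' {k l m : ℤ} {x y : S.E} (hx : x ∈ S.pE k) (hy : y ∈ S.pE l) (h : m ≤ k + l) :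
    x * y ∈ S.pE m :=
  pE_anti h (mul_mem_pE hx hy)

lemma conj_mem_pE {k : ℤ} {x : S.E} (hx : x ∈ S.pE k) : S.conj x ∈ S.pE k := by
  rw [mem_pE] at *
  have := S.conj_O _ hx
  rwa [map_mul, map_zpow₀, S.unif_conj] at this

lemma unif_zpow_mem_pE (k : ℤ) : S.ϖ ^ k ∈ S.pE k := by
  rw [mem_pE, ← zpow_add₀ S.unif_ne, add_neg_cancel, zpow_zero]
  exact S.O.one_mem

lemma one_mem_pE_zero : (1 : S.E) ∈ S.pE 0 := by
  simpa using unif_zpow_mem_pE (S := S) 0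

lemma one_notMem_pE_one : (1 : S.E) ∉ S.pE 1 := by
  rintro ⟨w, hw, h⟩
  apply S.unif_not_unit
  rw [isUnit_iff_exists_inv]
  exact ⟨⟨w, hw⟩, Subtype.ext (by simpa using h.symm)⟩

lemma le_zero_of_one_mem_pE {k : ℤ} (h : (1 : S.E) ∈ S.pE k) : k ≤ 0 := by
  by_contra! hk
  exact one_notMem_pE_one (pE_anti hk h)

/-- Every nonzero element has an exact valuation. -/
lemma exists_val {x : S.E} (hx : x ≠ 0) : ∃ n : ℤ, x ∈ S.pE n ∧ x⁻¹ ∈ S.pE (-n) := by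
  obtain ⟨n, u, rfl⟩ := S.disc x hx
  refine ⟨n, ⟨(u : S.O), (u : S.O).2, mul_comm _ _⟩,
    ⟨((u⁻¹ : S.Oˣ) : S.O), ((u⁻¹ : S.Oˣ) : S.O).2, ?_⟩⟩
  have h1 : (((u : S.O) : S.E)) * (((u⁻¹ : S.Oˣ) : S.O) : S.E) = 1 := by
    rw [← Subring.coe_mul, u.mul_inv, Subring.coe_one]
  rw [mul_inv, zpow_neg, mul_comm, eq_inv_of_mul_eq_one_right h1]

lemma le_of_mem_of_inv_mem {x : S.E} (hx : x ≠ 0) {m n : ℤ} (h : x ∈ S.pE m)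
    (h' : x⁻¹ ∈ S.pE (-n)) : m ≤ n := by
  have := mul_mem_pE h h'
  rw [mul_inv_cancel₀ hx] at this
  have := le_zero_of_one_mem_pE this
  omega

lemma inv_mem_pE {x : S.E} {n : ℤ} (h : x ∉ S.pE (n + 1)) : x ≠ 0 ∧ x⁻¹ ∈ S.pE (-n) := by
  have hx : x ≠ 0 := by
    rintro rfl
    exact h (zero_mem_pE _)
  obtain ⟨m, h1, h2⟩ := exists_val hx
  have : m ≤ n := by
    by_contra! hc
    exact h (pE_anti hc h1)
  exact ⟨hx, pE_anti (by omega) h2⟩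

lemma mem_pE_of_norm {x : S.E} {k : ℤ} (h : x * S.conj x ∈ S.pE (2 * k - 1)) : x ∈ S.pE k := by
  by_cases hx : x = 0
  · rw [hx]
    exact zero_mem_pE _
  obtain ⟨m, h1, h2⟩ := exists_val hx
  by_contra hc
  have hm : m < k := by
    by_contra! hm
    exact hc (pE_anti hm h1)
  have h3 := conj_mem_pE h2
  rw [map_inv₀] at h3
  have h4 := mul_mem_pE h2 h3
  rw [← mul_inv] at h4
  have hne : x * S.conj x ≠ 0 := mul_ne_zero hx (by simpa using hx)
  have := le_of_mem_of_inv_mem (n := 2 * m) hne h (by convert h4 using 2; ring)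
  omega

lemma zpow_mem_pE_iff {n k : ℤ} : S.ϖ ^ n ∈ S.pE k ↔ k ≤ n := by
  refine ⟨fun h => ?_, fun h => pE_anti h (unif_zpow_mem_pE n)⟩
  refine le_of_mem_of_inv_mem (zpow_unif_ne n) h ?_
  rw [← zpow_neg]
  exact unif_zpow_mem_pE _

/-! ### Matrices of elements of `G` -/

lemma mat_mul (g h : S.GG) : S.mat (g * h) = S.mat g * S.mat h := rfl

lemma mat_one : S.mat (1 : S.GG) = 1 := rfl

lemma mat_injective {g h : S.GG} (H : S.mat g = S.mat h) : g = h :=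
  Subtype.ext (Units.ext H)

lemma mat_mem (g : S.GG) :
    (S.mat g).transpose * S.betaM * (S.mat g).map S.conj = S.betaM := g.2

lemma map_conj_conj (M : S.M3) : (M.map S.conj).map S.conj = M := by
  ext i j
  simp [S.conj_invol]

lemma betaM_map : S.betaM.map S.conj = S.betaM := by
  ext i j
  fin_cases i <;> fin_cases j <;> simp [betaM]

lemma adjoint_mul_of_form {M : S.M3} (h : M.transpose * S.betaM * M.map S.conj = S.betaM) :
    S.betaM * (M.map S.conj).transpose * S.betaM * M = 1 := by
  have h2 := congrArg (fun N : S.M3 => N.map S.conj) h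
  simp only [Matrix.map_mul, map_conj_conj, betaM_map, Matrix.transpose_map] at h2
  rw [mul_assoc, mul_assoc, ← mul_assoc _ S.betaM M, h2, beta_mul_beta]

/-- The element of `G` with a given matrix preserving the Hermitian form. -/
def ofMat (M : S.M3) (h : M.transpose * S.betaM * M.map S.conj = S.betaM) : S.GG :=
  ⟨⟨M, S.betaM * (M.map S.conj).transpose * S.betaM,
    mul_eq_one_comm.mp (adjoint_mul_of_form h), adjoint_mul_of_form h⟩, h⟩

lemma mat_ofMat (M : S.M3) (h) : S.mat (ofMat M h) = M := rfl

lemma mat_inv (g : S.GG) :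
    S.mat g⁻¹ = S.betaM * ((S.mat g).map S.conj).transpose * S.betaM := by
  have h1 := adjoint_mul_of_form (mat_mem g)
  have h2 : S.mat g * S.mat g⁻¹ = 1 := by rw [← mat_mul, mul_inv_cancel, mat_one]
  exact (left_inv_eq_right_inv h1 h2).symm

lemma mat_inv_apply (g : S.GG) (i j : Fin 3) :
    S.mat g⁻¹ i j = S.conj (S.mat g j.rev i.rev) := by
  rw [mat_inv]
  fin_cases i <;> fin_cases j <;>
    simp [betaM, Matrix.mul_apply, Matrix.vecMul, dotProduct, Fin.sum_univ_three, Fin.rev]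

lemma row_rel (g : S.GG) (i j : Fin 3) :
    S.mat g i 0 * S.conj (S.mat g j 2) + S.mat g i 1 * S.conj (S.mat g j 1) +
      S.mat g i 2 * S.conj (S.mat g j 0) = S.betaM i j := by
  have h2 : S.mat g * S.mat g⁻¹ = 1 := by rw [← mat_mul, mul_inv_cancel, mat_one]
  have h3 := congrFun (congrFun h2 i) j.rev
  rw [Matrix.mul_apply, Fin.sum_univ_three] at h3
  simp only [mat_inv_apply, Fin.rev_rev] at h3
  refine Eq.trans h3 ?_
  fin_cases i <;> fin_cases j <;> rfl

lemma col_rel (g : S.GG) (i j : Fin 3) :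
    S.mat g 0 i * S.conj (S.mat g 2 j) + S.mat g 1 i * S.conj (S.mat g 1 j) +
      S.mat g 2 i * S.conj (S.mat g 0 j) = S.betaM i j := by
  have h3 := congrFun (congrFun (mat_mem g) i) j
  rw [← h3]
  simp [betaM, Matrix.mul_apply, Fin.sum_univ_three]
  ring

lemma mat_alpha_zpow (n : ℤ) :
    S.mat (S.alphaE ^ n) = Matrix.diagonal ![S.ϖ ^ (-n), 1, S.ϖ ^ n] := by
  have h1 : S.mat S.alphaE = Matrix.diagonal ![S.ϖ⁻¹, 1, S.ϖ] := by
    ext i j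
    change S.alphaM i j = _
    fin_cases i <;> fin_cases j <;> simp [alphaM]
  have hnat : ∀ m : ℕ, S.mat (S.alphaE ^ m) =
      Matrix.diagonal ![S.ϖ ^ (-(m : ℤ)), 1, S.ϖ ^ (m : ℤ)] := by
    intro m
    induction m with
    | zero =>
      ext i j
      rw [pow_zero, mat_one]
      fin_cases i <;> fin_cases j <;> simp
    | succ m ih =>
      rw [pow_succ, mat_mul, ih, h1, Matrix.diagonal_mul_diagonal]
      congr 1
      ext i
      fin_cases i <;> simp [zpow_add₀ S.unif_ne, pow_succ, mul_comm]
  obtain ⟨m, rfl | rfl⟩ := n.eq_nat_or_neg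
  · rw [zpow_natCast]
    exact hnat m
  · ext i j
    rw [zpow_neg, zpow_natCast, mat_inv_apply, hnat]
    fin_cases i <;> fin_cases j <;> simp [Fin.rev, S.unif_conj]

/-- The matrix `M` has its `(i, j)` entry in `p_E ^ (a i j)`. -/
def HasPat (a : Matrix (Fin 3) (Fin 3) ℤ) (M : S.M3) : Prop := ∀ i j, M i j ∈ S.pE (a i j)

lemma HasPat.mul {a b c : Matrix (Fin 3) (Fin 3) ℤ} {M N : S.M3} (hM : HasPat a M)
    (hN : HasPat b N) (h : ∀ i j k, c i k ≤ a i j + b j k) : HasPat c (M * N) := by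
  intro i k
  rw [Matrix.mul_apply, Fin.sum_univ_three]
  exact add_mem_pE (add_mem_pE (mul_mem_pE' (hM i 0) (hN 0 k) (h i 0 k))
    (mul_mem_pE' (hM i 1) (hN 1 k) (h i 1 k))) (mul_mem_pE' (hM i 2) (hN 2 k) (h i 2 k))

lemma hasPat_inv {a : Matrix (Fin 3) (Fin 3) ℤ} {g : S.GG} (hg : HasPat a (S.mat g))
    (h : ∀ i j : Fin 3, a i j ≤ a j.rev i.rev) : HasPat a (S.mat g⁻¹) := by
  intro i j
  rw [mat_inv_apply]
  exact pE_anti (h i j) (conj_mem_pE (hg _ _))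

lemma hasPat_iff {a : Matrix (Fin 3) (Fin 3) ℤ} {M : S.M3} : HasPat a M ↔
    (M 0 0 ∈ S.pE (a 0 0) ∧ M 0 1 ∈ S.pE (a 0 1) ∧ M 0 2 ∈ S.pE (a 0 2)) ∧
    (M 1 0 ∈ S.pE (a 1 0) ∧ M 1 1 ∈ S.pE (a 1 1) ∧ M 1 2 ∈ S.pE (a 1 2)) ∧
    (M 2 0 ∈ S.pE (a 2 0) ∧ M 2 1 ∈ S.pE (a 2 1) ∧ M 2 2 ∈ S.pE (a 2 2)) := by
  simp [HasPat, Fin.forall_fin_succ]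

/-- Valuation pattern of `K`. -/
def KPat (ε : ℤ) : Matrix (Fin 3) (Fin 3) ℤ := !![0, 0, -ε; ε, 0, 0; ε, ε, 0]

/-- Valuation pattern of the Iwahori subgroup. -/
def IPat (ε : ℤ) : Matrix (Fin 3) (Fin 3) ℤ := !![0, 0, -ε; 1, 0, 0; 1 + ε, 1, 0]

/-- Valuation pattern of `g - 1` for `g` in the maximal normal pro-p subgroup of `K`. -/
def PPat (ε : ℤ) : Matrix (Fin 3) (Fin 3) ℤ := !![1, 1 - ε, 1 - ε; 1, 1, 1 - ε; 1 + ε, 1, 1]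

lemma hasPat_KPat {ε : ℤ} {M : S.M3} : HasPat (KPat ε) M ↔
    (M 0 0 ∈ S.pE 0 ∧ M 0 1 ∈ S.pE 0 ∧ M 0 2 ∈ S.pE (-ε)) ∧
    (M 1 0 ∈ S.pE ε ∧ M 1 1 ∈ S.pE 0 ∧ M 1 2 ∈ S.pE 0) ∧
    (M 2 0 ∈ S.pE ε ∧ M 2 1 ∈ S.pE ε ∧ M 2 2 ∈ S.pE 0) := hasPat_iff

lemma hasPat_IPat {ε : ℤ} {M : S.M3} : HasPat (IPat ε) M ↔
    (M 0 0 ∈ S.pE 0 ∧ M 0 1 ∈ S.pE 0 ∧ M 0 2 ∈ S.pE (-ε)) ∧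
    (M 1 0 ∈ S.pE 1 ∧ M 1 1 ∈ S.pE 0 ∧ M 1 2 ∈ S.pE 0) ∧
    (M 2 0 ∈ S.pE (1 + ε) ∧ M 2 1 ∈ S.pE 1 ∧ M 2 2 ∈ S.pE 0) := hasPat_iff

lemma hasPat_PPat {ε : ℤ} {M : S.M3} : HasPat (PPat ε) (M - 1) ↔
    (M 0 0 - 1 ∈ S.pE 1 ∧ M 0 1 ∈ S.pE (1 - ε) ∧ M 0 2 ∈ S.pE (1 - ε)) ∧
    (M 1 0 ∈ S.pE 1 ∧ M 1 1 - 1 ∈ S.pE 1 ∧ M 1 2 ∈ S.pE (1 - ε)) ∧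
    (M 2 0 ∈ S.pE (1 + ε) ∧ M 2 1 ∈ S.pE 1 ∧ M 2 2 - 1 ∈ S.pE 1) := by
  have h : ∀ i j : Fin 3, i ≠ j → (M - 1) i j = M i j := fun i j hij => by
    rw [Matrix.sub_apply, Matrix.one_apply_ne hij, sub_zero]
  have h' : ∀ i : Fin 3, (M - 1) i i = M i i - 1 := fun i => by
    rw [Matrix.sub_apply, Matrix.one_apply_eq]
  rw [hasPat_iff, h' 0, h' 1, h' 2, h 0 1 (by decide), h 0 2 (by decide), h 1 0 (by decide),
    h 1 2 (by decide), h 2 0 (by decide), h 2 1 (by decide)]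
  rfl

/-- Uniform description of the two maximal compact subgroups and their subgroups. -/
structure Uniform (C : Chamber S) (ε : ℤ) : Prop where
  hε : ε = 0 ∨ ε = 1
  memK : ∀ g, g ∈ C.K ↔ HasPat (KPat ε) (S.mat g)
  memIK : ∀ g, g ∈ C.IK ↔ HasPat (IPat ε) (S.mat g)
  memI1 : ∀ g, g ∈ C.I1 ↔ HasPat (IPat ε) (S.mat g) ∧ ∀ i, S.mat g i i - 1 ∈ S.pE 1
  memKone : ∀ g, g ∈ C.KoneS ↔ HasPat (PPat ε) (S.mat g - 1)
  matβ : S.mat C.βK = !![0, 0, S.ϖ ^ (-ε); 0, 1, 0; S.ϖ ^ ε, 0, 0]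

lemma mem_pE_zero_of_sub_one {x : S.E} (h : x - 1 ∈ S.pE 1) : x ∈ S.pE 0 := by
  have := add_mem_pE (pE_anti zero_le_one h) one_mem_pE_zero
  simpa using this

lemma exists_uniform (C : Chamber S) : ∃ ε, Uniform C ε := by
  rcases C.cases with ⟨hK, h1, hI, hI1, -, hβ, -⟩ | ⟨hK, h1, hI, hI1, -, hβ, -⟩
  · have hIK : ∀ g, g ∈ C.IK ↔ HasPat (IPat 0) (S.mat g) := by
      intro g
      rw [hasPat_IPat, hI]
      simp only [IK0, K0set, Set.mem_ofPred_eq, Fin.forall_fin_succ, ← mem_pE_zero]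
      simp only [Fin.forall_fin_zero, Fin.succ_zero_eq_one, Fin.succ_one_eq_two, and_true, neg_zero,
        add_zero]
      constructor
      · tauto
      · rintro ⟨⟨a, b, c⟩, ⟨d, e, f⟩, ⟨g, h, i⟩⟩
        have := pE_anti zero_le_one d
        have := pE_anti zero_le_one g
        have := pE_anti zero_le_one h
        tauto
    refine ⟨0, Or.inl rfl, fun g => ?_, hIK, fun g => ?_, fun g => ?_, ?_⟩
    · rw [← SetLike.mem_coe, hK, hasPat_KPat]
      simp only [K0set, Set.mem_ofPred_eq, Fin.forall_fin_succ, ← mem_pE_zero]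
      simp
    · rw [← hIK, hI1, I1K0, hI]
      simp only [Set.mem_ofPred_eq, Fin.forall_fin_succ]
      simp
    · rw [h1, Kone0, hasPat_iff]
      simp [PPat, Fin.forall_fin_succ]
    · rw [hβ]
      change S.betaM = _
      simp [betaM]
  · have hIK : ∀ g, g ∈ C.IK ↔ HasPat (IPat 1) (S.mat g) := by
      intro g
      rw [hasPat_IPat, hI]
      simp only [IK1, K1set, Set.mem_ofPred_eq, ← mem_pE_zero]
      norm_num
      constructor
      · tauto
      · rintro ⟨⟨a, b, c⟩, ⟨d, e, f⟩, ⟨g, h, i⟩⟩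
        have := pE_anti one_le_two g
        tauto
    refine ⟨1, Or.inr rfl, fun g => ?_, hIK, fun g => ?_, fun g => ?_, ?_⟩
    · rw [← SetLike.mem_coe, hK, hasPat_KPat]
      simp only [K1set, Set.mem_ofPred_eq, ← mem_pE_zero]
      tauto
    · rw [← hIK, hI1, I1K1, hI]
      simp only [Set.mem_ofPred_eq, Fin.forall_fin_succ]
      simp
    · rw [h1, Kone1, hasPat_PPat]
      simp only [K1set, Set.mem_ofPred_eq, ← mem_pE_zero]
      norm_num
      constructor
      · tauto
      · rintro ⟨⟨a, b, c⟩, ⟨d, e, f⟩, ⟨g, h, i⟩⟩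
        have := mem_pE_zero_of_sub_one a
        have := mem_pE_zero_of_sub_one e
        have := mem_pE_zero_of_sub_one i
        have := pE_anti one_le_two g
        have := pE_anti (show (-1 : ℤ) ≤ 0 by norm_num) c
        tauto
    · rw [hβ]
      change S.betaM * S.mat (S.alphaE⁻¹) = _
      rw [← zpow_neg_one, mat_alpha_zpow]
      ext i j
      fin_cases i <;> fin_cases j <;> simp [betaM, Matrix.mul_apply, Fin.sum_univ_three]

end Setting

namespace Setting

variable {S : Setting}

lemma nM_form {x y : S.E} (h : x * S.conj x + y + S.conj y = 0) :
    (S.nM x y).transpose * S.betaM * (S.nM x y).map S.conj = S.betaM := by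
  ext i j
  fin_cases i <;> fin_cases j <;>
    simp [nM, betaM, Matrix.mul_apply, Fin.sum_univ_three, S.conj_invol]
  linear_combination h

/-- The element of `G` is lower triangular. -/
def IsLower (l : S.GG) : Prop := S.mat l 0 1 = 0 ∧ S.mat l 0 2 = 0 ∧ S.mat l 1 2 = 0

/-- The element of `G` is upper unipotent. -/
def IsUp (u : S.GG) : Prop :=
  S.mat u 1 0 = 0 ∧ S.mat u 2 0 = 0 ∧ S.mat u 2 1 = 0 ∧ ∀ i, S.mat u i i = 1

lemma isUp_of_mat {u : S.GG} {x y : S.E} (h : S.mat u = S.nM x y) : IsUp u := by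
  refine ⟨?_, ?_, ?_, fun i => ?_⟩
  · simp [h, nM]
  · simp [h, nM]
  · simp [h, nM]
  · fin_cases i <;> simp [h, nM]

lemma exists_lower_mul_upper {g : S.GG} (h : S.mat g 0 0 ≠ 0) : ∃ l u : S.GG, g = l * u ∧
    IsLower l ∧ S.mat u = S.nM (S.mat g 0 1 / S.mat g 0 0) (S.mat g 0 2 / S.mat g 0 0) ∧
    ∀ i, S.mat l i 0 = S.mat g i 0 := by
  set x := S.mat g 0 1 / S.mat g 0 0 with hx
  set y := S.mat g 0 2 / S.mat g 0 0 with hy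
  have h' : S.conj (S.mat g 0 0) ≠ 0 := by simpa using h
  have hxy : x * S.conj x + y + S.conj y = 0 := by
    have := row_rel g 0 0
    simp only [betaM, Matrix.of_apply, Matrix.cons_val_zero] at this
    rw [hx, hy, map_div₀, map_div₀]
    field_simp
    linear_combination this
  obtain ⟨u, hu⟩ : ∃ u : S.GG, S.mat u = S.nM x y := ⟨_, mat_ofMat _ (nM_form hxy)⟩
  obtain ⟨l, rfl⟩ : ∃ l, g = l * u := ⟨g * u⁻¹, by group⟩
  have hmul : S.mat (l * u) = S.mat l * S.nM x y := by rw [mat_mul, hu]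
  have h0 : ∀ i, S.mat (l * u) i 0 = S.mat l i 0 := fun i => by
    simp [hmul, Matrix.mul_apply, Fin.sum_univ_three, nM]
  have h1 : S.mat l 0 1 = 0 := by
    have hx' : S.mat (l * u) 0 0 * x = S.mat (l * u) 0 1 := by rw [hx]; field_simp
    have : S.mat (l * u) 0 1 = S.mat l 0 0 * x + S.mat l 0 1 := by
      rw [hmul]; simp [Matrix.mul_apply, Fin.sum_univ_three, nM]
    rw [h0] at hx'
    linear_combination -hx' - this
  have h2 : S.mat l 0 2 = 0 := by
    have hy' : S.mat (l * u) 0 0 * y = S.mat (l * u) 0 2 := by rw [hy]; field_simp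
    have : S.mat (l * u) 0 2 = S.mat l 0 0 * y + S.mat l 0 2 := by
      rw [hmul]; simp [Matrix.mul_apply, Fin.sum_univ_three, nM, h1]
    rw [h0] at hy'
    linear_combination -hy' - this
  refine ⟨l, u, rfl, ⟨h1, h2, ?_⟩, hu, fun i => (h0 i).symm⟩
  have := row_rel l 0 1
  rw [h1, h2, ← h0] at this
  simpa [betaM, h] using this

lemma IsLower.rel {l : S.GG} (hl : IsLower l) :
    S.mat l 0 0 * S.conj (S.mat l 2 2) = 1 ∧ S.mat l 1 1 * S.conj (S.mat l 1 1) = 1 ∧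
      S.mat l 2 2 * S.conj (S.mat l 0 0) = 1 := by
  obtain ⟨h1, h2, h3⟩ := hl
  refine ⟨?_, ?_, ?_⟩
  · have := row_rel l 0 2
    rw [h1, h2] at this
    simpa [betaM] using this
  · have := row_rel l 1 1
    rw [h3] at this
    simpa [betaM] using this
  · have := row_rel l 2 0
    rw [h1, h2] at this
    simpa [betaM] using this

lemma IsLower.exists_diag {l : S.GG} (hl : IsLower l) :
    ∃ d : S.GG, S.mat d = Matrix.diagonal ![S.mat l 0 0, S.mat l 1 1, S.mat l 2 2] := by
  obtain ⟨h1, h2, h3⟩ := hl.rel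
  refine ⟨ofMat _ ?_, mat_ofMat _ _⟩
  ext i j
  fin_cases i <;> fin_cases j <;>
    simp [betaM, Matrix.mul_apply, Matrix.diagonal_apply, h1, h2, h3]

lemma mat_alpha_mul_mul (g : S.GG) (m n : ℤ) (i j : Fin 3) :
    S.mat (S.alphaE ^ m * g * S.alphaE ^ n) i j =
      ![S.ϖ ^ (-m), 1, S.ϖ ^ m] i * S.mat g i j * ![S.ϖ ^ (-n), 1, S.ϖ ^ n] j := by
  rw [mat_mul, mat_mul, mat_alpha_zpow, mat_alpha_zpow, Matrix.mul_diagonal, Matrix.diagonal_mul]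

namespace Uniform

variable {C : Chamber S} {ε : ℤ} (U : Uniform C ε)

include U

lemma I1_sub_IK {g : S.GG} (h : g ∈ C.I1) : g ∈ C.IK :=
  (U.memIK g).2 ((U.memI1 g).1 h).1

lemma IK_sub_K {g : S.GG} (h : g ∈ C.IK) : g ∈ C.K := by
  have hε := U.hε
  obtain ⟨⟨a, b, c⟩, ⟨d, e, f⟩, ⟨g, h, i⟩⟩ := hasPat_IPat.1 ((U.memIK g).1 h)
  exact (U.memK _).2 (hasPat_KPat.2 ⟨⟨a, b, c⟩, ⟨pE_anti (by omega) d, e, f⟩,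
    ⟨pE_anti (by omega) g, pE_anti (by omega) h, i⟩⟩)

lemma I1_sub_K {g : S.GG} (h : g ∈ C.I1) : g ∈ C.K := U.IK_sub_K (U.I1_sub_IK h)

lemma IK_mul {g h : S.GG} (hg : g ∈ C.IK) (hh : h ∈ C.IK) : g * h ∈ C.IK := by
  have hε := U.hε
  rw [U.memIK] at *
  refine hg.mul hh ?_
  simp only [Fin.forall_fin_succ]
  simp [IPat]
  omega

lemma IK_inv {g : S.GG} (hg : g ∈ C.IK) : g⁻¹ ∈ C.IK := by
  rw [U.memIK] at *
  refine hasPat_inv hg ?_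
  simp only [Fin.forall_fin_succ]
  simp [IPat, Fin.rev]

lemma one_mem_IK : (1 : S.GG) ∈ C.IK := by
  rw [U.memIK, hasPat_IPat, mat_one]
  simp [zero_mem_pE, one_mem_pE_zero]

lemma one_mem_I1 : (1 : S.GG) ∈ C.I1 := by
  rw [U.memI1, ← U.memIK]
  refine ⟨U.one_mem_IK, fun i => ?_⟩
  rw [mat_one, Matrix.one_apply_eq, sub_self]
  exact zero_mem_pE _

lemma up_mem_I1 {u : S.GG} (hu : u ∈ C.K) (h : IsUp u) : u ∈ C.I1 := by
  obtain ⟨h1, h2, h3, h4⟩ := h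
  obtain ⟨⟨a, b, c⟩, ⟨d, e, f⟩, ⟨g, h, i⟩⟩ := hasPat_KPat.1 ((U.memK u).1 hu)
  rw [U.memI1, hasPat_IPat, h1, h2, h3]
  refine ⟨⟨⟨a, b, c⟩, ⟨zero_mem_pE _, e, f⟩, ⟨zero_mem_pE _, zero_mem_pE _, i⟩⟩, fun j => ?_⟩
  rw [h4, sub_self]
  exact zero_mem_pE _

lemma nM_mem_I1 {u : S.GG} {x y : S.E} (h : S.mat u = S.nM x y) (hx : x ∈ S.pE 0)
    (hy : y ∈ S.pE (-ε)) : u ∈ C.I1 := by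
  refine U.up_mem_I1 ?_ (isUp_of_mat h)
  rw [U.memK, h, hasPat_KPat]
  simp [nM, zero_mem_pE, one_mem_pE_zero, hx, hy, neg_mem_pE (conj_mem_pE hx)]

lemma β_mem_K : C.βK ∈ C.K := by
  rw [U.memK, U.matβ, hasPat_KPat]
  simp [zero_mem_pE, one_mem_pE_zero, unif_zpow_mem_pE]
  rw [← zpow_neg]
  exact unif_zpow_mem_pE _

lemma β_mul_β : C.βK * C.βK = 1 := by
  apply mat_injective
  rw [mat_mul, U.matβ, mat_one]
  ext i j
  fin_cases i <;> fin_cases j <;>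
    simp [Matrix.mul_apply, Fin.sum_univ_three, zpow_unif_ne]

lemma β_notMem_IK : C.βK ∉ C.IK := by
  intro h
  rw [U.memIK, hasPat_IPat, U.matβ] at h
  have := h.2.2.1
  simp [zpow_mem_pE_iff] at this

lemma mat_β_mul (g : S.GG) (j : Fin 3) : S.mat (C.βK * g) 0 j = S.ϖ ^ (-ε) * S.mat g 2 j ∧
    S.mat (C.βK * g) 1 j = S.mat g 1 j ∧ S.mat (C.βK * g) 2 j = S.ϖ ^ ε * S.mat g 0 j := by
  rw [mat_mul, U.matβ]
  simp [Matrix.mul_apply, Fin.sum_univ_three]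

lemma mat_mul_β (g : S.GG) (i : Fin 3) : S.mat (g * C.βK) i 0 = S.mat g i 2 * S.ϖ ^ ε ∧
    S.mat (g * C.βK) i 1 = S.mat g i 1 ∧ S.mat (g * C.βK) i 2 = S.mat g i 0 * S.ϖ ^ (-ε) := by
  rw [mat_mul, U.matβ]
  simp [Matrix.mul_apply, Fin.sum_univ_three]

lemma alpha_neg (n : ℤ) : S.alphaE ^ (-n) = C.βK * S.alphaE ^ n * C.βK := by
  apply mat_injective
  rw [mat_mul, mat_mul, U.matβ, mat_alpha_zpow, mat_alpha_zpow, mul_assoc]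
  have := zpow_unif_ne (S := S) ε
  have := zpow_unif_ne (S := S) n
  ext i j
  fin_cases i <;> fin_cases j <;>
    simp [Matrix.mul_apply, Fin.sum_univ_three] <;> field_simp

/-- The Bruhat decomposition of `K`, with the opposite Borel subgroup on the left. -/
lemma bruhat {g : S.GG} (hg : g ∈ C.K) : ∃ l ∈ C.K, IsLower l ∧
    ((∃ u ∈ C.K, IsUp u ∧ g = l * u) ∨ ∃ u ∈ C.I1, g = l * C.βK * u) := by
  have hε := U.hε
  obtain ⟨⟨a, b, c⟩, ⟨d, e, f⟩, ⟨g', h, i⟩⟩ := hasPat_KPat.1 ((U.memK g).1 hg)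
  by_cases h0 : S.mat g 0 0 ∈ S.pE 1
  · have h01 : S.mat g 0 1 ∈ S.pE (1 - ε) := by
      apply mem_pE_of_norm
      have := row_rel g 0 0
      simp only [betaM, Matrix.of_apply, Matrix.cons_val_zero] at this
      rw [show S.mat g 0 1 * S.conj (S.mat g 0 1) = -(S.mat g 0 0 * S.conj (S.mat g 0 2) +
        S.mat g 0 2 * S.conj (S.mat g 0 0)) by linear_combination this]
      exact neg_mem_pE (add_mem_pE (mul_mem_pE' h0 (conj_mem_pE c) (by omega))
        (mul_mem_pE' c (conj_mem_pE h0) (by omega)))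
    obtain ⟨e1, e2, e3⟩ := U.mat_mul_β g 0
    have hc : S.mat (g * C.βK) 0 0 ∉ S.pE (0 + 1) := by
      intro hc
      rw [e1] at hc
      have hc' : S.mat g 0 2 ∈ S.pE (1 - ε) := by
        have := mul_mem_pE hc (unif_zpow_mem_pE (-ε))
        rw [mul_assoc, ← zpow_add₀ S.unif_ne, add_neg_cancel, zpow_zero, mul_one] at this
        exact pE_anti (by omega) this
      have hr := row_rel g 0 2
      have h1 : S.betaM 0 2 = 1 := by simp [betaM]
      rw [h1] at hr
      apply one_notMem_pE_one (S := S)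
      rw [← hr]
      exact add_mem_pE (add_mem_pE (mul_mem_pE' h0 (conj_mem_pE i) (by omega))
        (mul_mem_pE' h01 (conj_mem_pE h) (by omega))) (mul_mem_pE' hc' (conj_mem_pE g') (by omega))
    obtain ⟨hne, hinv⟩ := inv_mem_pE hc
    obtain ⟨l, u, hlu, hl, hu, -⟩ := exists_lower_mul_upper hne
    rw [div_eq_mul_inv, div_eq_mul_inv, e2, e3] at hu
    have hx : S.mat g 0 1 * (S.mat (g * C.βK) 0 0)⁻¹ ∈ S.pE (1 - ε) :=
      mul_mem_pE' h01 hinv (by omega)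
    have hy : S.mat g 0 0 * S.ϖ ^ (-ε) * (S.mat (g * C.βK) 0 0)⁻¹ ∈ S.pE (1 - ε) :=
      mul_mem_pE' (mul_mem_pE h0 (unif_zpow_mem_pE (-ε))) hinv (by omega)
    have huK : u ∈ C.K := U.I1_sub_K
      (U.nM_mem_I1 hu (pE_anti (by omega) hx) (pE_anti (by omega) hy))
    refine ⟨l, ?_, hl, Or.inr ⟨C.βK * u * C.βK, ?_, ?_⟩⟩
    · rw [show l = g * C.βK * u⁻¹ by rw [hlu]; group]
      exact C.K.mul_mem (C.K.mul_mem hg U.β_mem_K) (C.K.inv_mem huK)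
    · set x := S.mat g 0 1 * (S.mat (g * C.βK) 0 0)⁻¹
      set y := S.mat g 0 0 * S.ϖ ^ (-ε) * (S.mat (g * C.βK) 0 0)⁻¹
      have hm : S.mat (C.βK * u * C.βK) = !![1, 0, 0; -(S.ϖ ^ ε * S.conj x), 1, 0;
          S.ϖ ^ ε * y * S.ϖ ^ ε, S.ϖ ^ ε * x, 1] := by
        rw [mat_mul, mat_mul, U.matβ, hu]
        have := zpow_unif_ne (S := S) ε
        ext i j
        fin_cases i <;> fin_cases j <;>
          simp [nM, Matrix.mul_apply, Fin.sum_univ_three] <;> field_simp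
      have hϖ := unif_zpow_mem_pE (S := S) ε
      rw [U.memI1, hm, hasPat_IPat]
      refine ⟨?_, fun i => ?_⟩
      · refine ⟨⟨?_, ?_, ?_⟩, ⟨?_, ?_, ?_⟩, ⟨?_, ?_, ?_⟩⟩ <;>
          simp only [Matrix.of_apply, Matrix.cons_val_zero, Matrix.cons_val_one, Matrix.cons_val]
        · exact one_mem_pE_zero
        · exact zero_mem_pE _
        · exact zero_mem_pE _
        · exact neg_mem_pE (mul_mem_pE' hϖ (conj_mem_pE hx) (by omega))
        · exact one_mem_pE_zero
        · exact zero_mem_pE _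
        · exact mul_mem_pE' (mul_mem_pE hϖ hy) hϖ (by omega)
        · exact mul_mem_pE' hϖ hx (by omega)
        · exact one_mem_pE_zero
      · fin_cases i <;> simp [zero_mem_pE]
    · have := U.β_mul_β
      rw [← mul_assoc, ← mul_assoc, mul_assoc l, this, mul_one, ← hlu, mul_assoc, this, mul_one]
  · obtain ⟨hne, hinv⟩ := inv_mem_pE (n := 0) (by simpa using h0)
    obtain ⟨l, u, hlu, hl, hu, -⟩ := exists_lower_mul_upper hne
    rw [div_eq_mul_inv, div_eq_mul_inv] at hu
    have huK : u ∈ C.K := U.I1_sub_K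
      (U.nM_mem_I1 hu (mul_mem_pE' b hinv (by omega)) (mul_mem_pE' c hinv (by omega)))
    refine ⟨l, ?_, hl, Or.inl ⟨u, huK, isUp_of_mat hu, hlu⟩⟩
    rw [show l = g * u⁻¹ by rw [hlu]; group]
    exact C.K.mul_mem hg (C.K.inv_mem huK)

lemma IK_decomp {g : S.GG} (hg : g ∈ C.IK) : ∃ h ∈ C.H0, ∃ i ∈ C.I1, g = h * i := by
  have hε := U.hε
  obtain ⟨⟨a, b, c⟩, ⟨d, e, f⟩, ⟨g', h, i⟩⟩ := hasPat_IPat.1 ((U.memIK g).1 hg)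
  have h0 : S.mat g 0 0 ∉ S.pE (0 + 1) := by
    intro h0
    have hr := row_rel g 0 2
    have h1 : S.betaM 0 2 = 1 := by simp [betaM]
    rw [h1] at hr
    apply one_notMem_pE_one (S := S)
    rw [← hr]
    exact add_mem_pE (add_mem_pE (mul_mem_pE' h0 (conj_mem_pE i) (by omega))
      (mul_mem_pE' b (conj_mem_pE h) (by omega))) (mul_mem_pE' c (conj_mem_pE g') (by omega))
  obtain ⟨hne, hinv⟩ := inv_mem_pE h0
  obtain ⟨l, u, hlu, hl, hu, -⟩ := exists_lower_mul_upper hne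
  rw [div_eq_mul_inv, div_eq_mul_inv] at hu
  set x := S.mat g 0 1 * (S.mat g 0 0)⁻¹
  set y := S.mat g 0 2 * (S.mat g 0 0)⁻¹
  have hx : x ∈ S.pE 0 := mul_mem_pE' b hinv (by omega)
  have hy : y ∈ S.pE (-ε) := mul_mem_pE' c hinv (by omega)
  have hlI : l ∈ C.IK := by
    rw [show l = g * u⁻¹ by rw [hlu]; group]
    exact U.IK_mul hg (U.IK_inv (U.I1_sub_IK (U.nM_mem_I1 hu hx hy)))
  obtain ⟨⟨a', b', c'⟩, ⟨d', e', f'⟩, ⟨g'', h', i'⟩⟩ := hasPat_IPat.1 ((U.memIK l).1 hlI)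
  obtain ⟨t, ht⟩ := hl.exists_diag
  have htI : t ∈ C.IK := by
    rw [U.memIK, ht, hasPat_IPat]
    simp [zero_mem_pE, a', e', i']
  have htH : t ∈ S.Hset := by
    refine ⟨S.mat l 0 0, S.mat l 1 1, S.mat l 2 2, ?_⟩
    rw [ht]
    ext i j
    fin_cases i <;> fin_cases j <;> simp
  refine ⟨t, ⟨htH, htI⟩, t⁻¹ * g, ?_, by group⟩
  rw [U.memI1, ← U.memIK]
  refine ⟨U.IK_mul (U.IK_inv htI) hg, ?_⟩
  have hM : S.mat g = S.mat t * S.mat (t⁻¹ * g) := by rw [← mat_mul]; group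
  have hM' : S.mat g = S.mat l * S.nM x y := by rw [← hu, ← mat_mul, ← hlu]
  obtain ⟨r1, r2, r3⟩ := hl.rel
  have key : ∀ z w v k : S.E, z * v = 1 → v ∈ S.pE 0 → w = z * k → w - z ∈ S.pE 1 →
      k - 1 ∈ S.pE 1 := by
    intro z w v k hz hv hw hwz
    have := mul_mem_pE hwz hv
    rw [hw] at this
    rw [show (z * k - z) * v = k - 1 by linear_combination (k - 1) * hz] at this
    simpa using this
  have ent : ∀ i, S.mat g i i = ![S.mat l 0 0, S.mat l 1 1, S.mat l 2 2] i *
      S.mat (t⁻¹ * g) i i := by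
    intro i
    rw [← Matrix.diagonal_mul, ← ht, ← hM]
  have hc : ∀ z ∈ S.pE 0, S.conj z ∈ S.pE 0 := fun z hz => conj_mem_pE hz
  intro i
  fin_cases i
  · refine key (S.mat l 0 0) _ _ _ r1 (hc _ i') (ent 0) ?_
    rw [hM']
    simpa [nM, Matrix.mul_apply, Fin.sum_univ_three] using zero_mem_pE 1
  · refine key (S.mat l 1 1) _ _ _ r2 (hc _ e') (ent 1) ?_
    rw [hM']
    simpa [nM, Matrix.mul_apply, Fin.sum_univ_three] using mul_mem_pE d' hx
  · refine key (S.mat l 2 2) _ _ _ r3 (hc _ a') (ent 2) ?_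
    rw [hM']
    have h1 := mul_mem_pE' (m := 1) g'' hy (by omega)
    have h2 := mul_mem_pE h' (hc _ hx)
    simpa [nM, Matrix.mul_apply, Fin.sum_univ_three, sub_eq_add_neg] using sub_mem_pE h1 h2

lemma conj_Kone {k z : S.GG} (hk : k ∈ C.K) (hz : z ∈ C.KoneS) : k⁻¹ * z * k ∈ C.KoneS := by
  have hε := U.hε
  have hk' := C.K.inv_mem hk
  rw [U.memKone] at *
  rw [U.memK] at hk hk'
  have : S.mat (k⁻¹ * z * k) - 1 = S.mat k⁻¹ * (S.mat z - 1) * S.mat k := by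
    rw [mul_sub, sub_mul, mul_one, ← mat_mul, ← mat_mul, ← mat_mul, inv_mul_cancel, mat_one]
  rw [this]
  refine (hk'.mul hz (c := PPat ε) ?_).mul hk ?_ <;>
  · simp only [Fin.forall_fin_succ]
    simp [PPat, KPat]
    omega

lemma alpha_conj_lower {l : S.GG} (hl : l ∈ C.K) (h : IsLower l) {n : ℤ} (hn : 1 ≤ n) :
    S.alphaE ^ n * l * S.alphaE ^ (-n) ∈ C.IK := by
  have hε := U.hε
  obtain ⟨h1, h2, h3⟩ := h
  obtain ⟨⟨a, b, c⟩, ⟨d, e, f⟩, ⟨g', h, i⟩⟩ := hasPat_KPat.1 ((U.memK l).1 hl)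
  have hϖ := unif_zpow_mem_pE (S := S) n
  have hne := zpow_unif_ne (S := S) n
  rw [U.memIK, hasPat_IPat]
  simp only [mat_alpha_mul_mul, h1, h2, h3, neg_neg, Matrix.cons_val_zero, Matrix.cons_val_one,
    Matrix.cons_val, mul_zero, zero_mul, zero_mem_pE, and_true, one_mul, mul_one, e]
  refine ⟨?_, mul_mem_pE' d hϖ (by omega), mul_mem_pE' (mul_mem_pE hϖ g') hϖ (by omega),
    mul_mem_pE' hϖ h (by omega), ?_⟩
  · rwa [mul_right_comm, ← zpow_add₀ S.unif_ne, neg_add_cancel, zpow_zero, one_mul]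
  · rwa [mul_right_comm, ← zpow_add₀ S.unif_ne, add_neg_cancel, zpow_zero, one_mul]

lemma alpha_conj_up {u : S.GG} (hu : u ∈ C.K) (h : IsUp u) {n : ℤ} (hn : 0 ≤ n) :
    S.alphaE ^ (-n) * u * S.alphaE ^ n ∈ C.K := by
  have hε := U.hε
  obtain ⟨h1, h2, h3, h4⟩ := h
  obtain ⟨⟨a, b, c⟩, ⟨d, e, f⟩, ⟨g', h, i⟩⟩ := hasPat_KPat.1 ((U.memK u).1 hu)
  have hϖ := unif_zpow_mem_pE (S := S) n
  have hne := zpow_unif_ne (S := S) n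
  rw [U.memK, hasPat_KPat]
  simp only [mat_alpha_mul_mul, h1, h2, h3, h4, neg_neg, Matrix.cons_val_zero, Matrix.cons_val_one,
    Matrix.cons_val, mul_zero, zero_mul, zero_mem_pE, true_and, and_true, one_mul, mul_one,
    one_mem_pE_zero, ← zpow_add₀ S.unif_ne, add_neg_cancel, neg_add_cancel, zpow_zero]
  exact ⟨⟨mul_mem_pE' hϖ b (by omega), mul_mem_pE' (mul_mem_pE hϖ c) hϖ (by omega)⟩,
    mul_mem_pE' f hϖ (by omega)⟩

lemma β_conj_lower {l : S.GG} (hl : l ∈ C.K) (h : IsLower l) : C.βK * l * C.βK ∈ C.IK := by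
  have hε := U.hε
  obtain ⟨h1, h2, h3⟩ := h
  have := C.K.mul_mem (C.K.mul_mem U.β_mem_K hl) U.β_mem_K
  obtain ⟨⟨a, b, c⟩, ⟨d, e, f⟩, ⟨g', h, i⟩⟩ := hasPat_KPat.1 ((U.memK _).1 this)
  rw [U.memIK, hasPat_IPat]
  refine ⟨⟨a, b, c⟩, ⟨?_, e, f⟩, ⟨?_, ?_, i⟩⟩
  · rw [(U.mat_mul_β _ 1).1, (U.mat_β_mul _ _).2.1, h3, zero_mul]
    exact zero_mem_pE _
  · rw [(U.mat_mul_β _ 2).1, (U.mat_β_mul _ _).2.2, h2, mul_zero, zero_mul]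
    exact zero_mem_pE _
  · rw [(U.mat_mul_β _ 2).2.1, (U.mat_β_mul _ _).2.2, h1, mul_zero]
    exact zero_mem_pE _

/-- The double cosets `K α^m I_{1,K}` are pairwise disjoint. -/
lemma alpha_eq {m n : ℤ} {k i : S.GG} (hk : k ∈ C.K) (hi : i ∈ C.I1)
    (h : S.alphaE ^ n = k * S.alphaE ^ m * i) : m = n := by
  have hi' := ((U.memI1 i).1 hi).2
  have hk' : S.alphaE ^ m * i * S.alphaE ^ (-n) ∈ C.K := by
    rw [show S.alphaE ^ m * i * S.alphaE ^ (-n) = k⁻¹ by rw [zpow_neg, h]; group]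
    exact C.K.inv_mem hk
  obtain ⟨⟨a, -, -⟩, -, ⟨-, -, b⟩⟩ := hasPat_KPat.1 ((U.memK _).1 hk')
  simp only [mat_alpha_mul_mul, neg_neg, Matrix.cons_val_zero, Matrix.cons_val] at a b
  have key : ∀ (x : S.E) (r s : ℤ), x - 1 ∈ S.pE 1 → S.ϖ ^ r * x * S.ϖ ^ s ∈ S.pE 0 →
      0 ≤ r + s := by
    intro x r s hx hrs
    by_contra! hc
    rw [mul_right_comm, ← zpow_add₀ S.unif_ne] at hrs
    have h1 := mul_mem_pE hrs (unif_zpow_mem_pE (-(r + s)))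
    rw [mul_right_comm, ← zpow_add₀ S.unif_ne, add_neg_cancel, zpow_zero, one_mul] at h1
    apply one_notMem_pE_one (S := S)
    have := sub_mem_pE (pE_anti (show 1 ≤ 0 + -(r + s) by omega) h1) hx
    simpa using this
  have := key _ _ _ (hi' 0) a
  have := key _ _ _ (hi' 2) b
  omega

omit U in
/-- The corner entries of `g` have normalized valuation at least `k`. -/
def Corner (_ : Uniform C ε) (k : ℤ) (g : S.GG) : Prop :=
  S.mat g 0 0 ∈ S.pE k ∧ S.mat g 0 2 ∈ S.pE (k - ε) ∧ S.mat g 2 0 ∈ S.pE (k + ε) ∧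
    S.mat g 2 2 ∈ S.pE k

lemma Corner.full {k : ℤ} {g : S.GG} (h : U.Corner k g) :
    S.mat g 0 1 ∈ S.pE k ∧ S.mat g 1 0 ∈ S.pE (k + ε) ∧ S.mat g 1 2 ∈ S.pE k ∧
      S.mat g 2 1 ∈ S.pE (k + ε) := by
  have hε := U.hε
  obtain ⟨a, b, c, d⟩ := h
  have key : ∀ (x y z : S.E) (r s t : ℤ), x * S.conj z + y * S.conj y + z * S.conj x = 0 →
      x ∈ S.pE r → z ∈ S.pE s → 2 * t - 1 ≤ r + s → y ∈ S.pE t := by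
    intro x y z r s t h hx hz ht
    apply mem_pE_of_norm
    rw [show y * S.conj y = -(x * S.conj z + z * S.conj x) by linear_combination h]
    exact neg_mem_pE (add_mem_pE (mul_mem_pE' hx (conj_mem_pE hz) ht)
      (mul_mem_pE' hz (conj_mem_pE hx) (by omega)))
  exact ⟨key _ _ _ _ _ _ (row_rel g 0 0) a b (by omega),
    key _ _ _ _ _ _ (col_rel g 0 0) a c (by omega),
    key _ _ _ _ _ _ (col_rel g 2 2) b d (by omega),
    key _ _ _ _ _ _ (row_rel g 2 2) c d (by omega)⟩

lemma Corner.mem_K {g : S.GG} (h : U.Corner 0 g) : g ∈ C.K := by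
  have hε := U.hε
  obtain ⟨h01, h10, h12, h21⟩ := Corner.full U h
  obtain ⟨a, b, c, d⟩ := h
  simp only [zero_sub, zero_add] at *
  rw [U.memK, hasPat_KPat]
  refine ⟨⟨a, h01, b⟩, ⟨h10, ?_, h12⟩, ⟨c, h21, d⟩⟩
  apply mem_pE_of_norm
  have h1 := col_rel g 1 1
  have h2 : S.betaM 1 1 = 1 := by simp [betaM]
  rw [h2] at h1
  rw [show S.mat g 1 1 * S.conj (S.mat g 1 1) = 1 - (S.mat g 0 1 * S.conj (S.mat g 2 1) +
    S.mat g 2 1 * S.conj (S.mat g 0 1)) by linear_combination h1]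
  exact sub_mem_pE (pE_anti (by omega) one_mem_pE_zero)
    (add_mem_pE (mul_mem_pE' h01 (conj_mem_pE h21) (by omega))
      (mul_mem_pE' h21 (conj_mem_pE h01) (by omega)))

lemma Corner.β_mul {k : ℤ} {g : S.GG} (h : U.Corner k g) : U.Corner k (C.βK * g) := by
  obtain ⟨a, b, c, d⟩ := h
  have h1 := unif_zpow_mem_pE (S := S) ε
  have h2 := unif_zpow_mem_pE (S := S) (-ε)
  unfold Corner
  simp only [U.mat_β_mul]
  exact ⟨mul_mem_pE' h2 c (by omega), mul_mem_pE' h2 d (by omega), mul_mem_pE' h1 a (by omega),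
    mul_mem_pE' h1 b (by omega)⟩

lemma Corner.mul_β {k : ℤ} {g : S.GG} (h : U.Corner k g) : U.Corner k (g * C.βK) := by
  obtain ⟨a, b, c, d⟩ := h
  have h1 := unif_zpow_mem_pE (S := S) ε
  have h2 := unif_zpow_mem_pE (S := S) (-ε)
  unfold Corner
  simp only [U.mat_mul_β]
  exact ⟨mul_mem_pE' b h1 (by omega), mul_mem_pE' a h2 (by omega), mul_mem_pE' d h1 (by omega),
    mul_mem_pE' c h2 (by omega)⟩

lemma Corner.cartan {k : ℤ} {g : S.GG} (h : U.Corner k g) (h0 : S.mat g 0 0 ∉ S.pE (k + 1)) :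
    ∃ k₁ ∈ C.K, ∃ k₂ ∈ C.K, ∃ n : ℤ, g = k₁ * S.alphaE ^ n * k₂ := by
  have hε := U.hε
  obtain ⟨h01, h10, h12, h21⟩ := Corner.full U h
  obtain ⟨a, b, c, d⟩ := h
  obtain ⟨hne, hinv⟩ := inv_mem_pE h0
  obtain ⟨l, u, hlu, hl, hu, hcol⟩ := exists_lower_mul_upper hne
  rw [div_eq_mul_inv, div_eq_mul_inv] at hu
  have huK : u ∈ C.K := U.I1_sub_K
    (U.nM_mem_I1 hu (mul_mem_pE' h01 hinv (by omega)) (mul_mem_pE' b hinv (by omega)))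
  obtain ⟨r1, r2, r3⟩ := hl.rel
  obtain ⟨t, ht⟩ := hl.exists_diag
  have hMl : S.mat l = S.mat (l * t⁻¹) *
      Matrix.diagonal ![S.mat l 0 0, S.mat l 1 1, S.mat l 2 2] := by
    rw [← ht, ← mat_mul]; group
  have ent : ∀ i j, S.mat l i j = S.mat (l * t⁻¹) i j *
      ![S.mat l 0 0, S.mat l 1 1, S.mat l 2 2] j := by
    intro i j
    rw [← Matrix.mul_diagonal, ← hMl]
  have n0 : S.mat l 0 0 ≠ 0 := left_ne_zero_of_mul_eq_one r1
  have n1 : S.mat l 1 1 ≠ 0 := left_ne_zero_of_mul_eq_one r2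
  have n2 : S.mat l 2 2 ≠ 0 := left_ne_zero_of_mul_eq_one r3
  have d1 : ∀ i, S.mat (l * t⁻¹) i i = 1 := by
    intro i
    have := ent i i
    fin_cases i
    · exact mul_right_cancel₀ n0 (by simpa using this.symm)
    · exact mul_right_cancel₀ n1 (by simpa using this.symm)
    · exact mul_right_cancel₀ n2 (by simpa using this.symm)
  obtain ⟨l1, l2, l3⟩ := hl
  have z1 : S.mat (l * t⁻¹) 0 1 = 0 := by
    have := ent 0 1
    rw [l1] at this
    simpa [n1] using this
  have z2 : S.mat (l * t⁻¹) 0 2 = 0 := by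
    have := ent 0 2
    rw [l2] at this
    simpa [n2] using this
  have z3 : S.mat (l * t⁻¹) 1 2 = 0 := by
    have := ent 1 2
    rw [l3] at this
    simpa [n2] using this
  have w : ∀ i, S.mat g i 0 * (S.mat g 0 0)⁻¹ = S.mat (l * t⁻¹) i 0 := by
    intro i
    have := ent i 0
    simp only [Matrix.cons_val_zero, hcol] at this
    rw [this, mul_inv_cancel_right₀ hne]
  have m10 : S.mat (l * t⁻¹) 1 0 ∈ S.pE ε := by
    rw [← w]
    exact mul_mem_pE' h10 hinv (by omega)
  have m20 : S.mat (l * t⁻¹) 2 0 ∈ S.pE ε := by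
    rw [← w]
    exact mul_mem_pE' c hinv (by omega)
  have m21 : S.mat (l * t⁻¹) 2 1 ∈ S.pE ε := by
    have := row_rel (l * t⁻¹) 2 1
    rw [d1, d1, z3] at this
    simp [betaM] at this
    rw [show S.mat (l * t⁻¹) 2 1 = -S.conj (S.mat (l * t⁻¹) 1 0) by linear_combination this]
    exact neg_mem_pE (conj_mem_pE m10)
  have hl' : l * t⁻¹ ∈ C.K := by
    rw [U.memK, hasPat_KPat, z1, z2, z3, d1, d1, d1]
    exact ⟨⟨one_mem_pE_zero, zero_mem_pE _, zero_mem_pE _⟩, ⟨m10, one_mem_pE_zero, zero_mem_pE _⟩,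
      ⟨m20, m21, one_mem_pE_zero⟩⟩
  have ht' : t * S.alphaE ^ k ∈ C.K := by
    have hm : S.mat (t * S.alphaE ^ k) = Matrix.diagonal ![S.mat l 0 0 * S.ϖ ^ (-k), S.mat l 1 1,
        S.mat l 2 2 * S.ϖ ^ k] := by
      rw [mat_mul, ht, mat_alpha_zpow, Matrix.diagonal_mul_diagonal]
      congr 1
      ext i
      fin_cases i <;> simp
    have p0 : S.mat l 0 0 * S.ϖ ^ (-k) ∈ S.pE 0 := by
      rw [hcol]
      exact mul_mem_pE' a (unif_zpow_mem_pE _) (by omega)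
    have p1 : S.mat l 1 1 ∈ S.pE 0 := by
      apply mem_pE_of_norm
      rw [r2]
      exact pE_anti (by norm_num) one_mem_pE_zero
    have p2 : S.mat l 2 2 * S.ϖ ^ k ∈ S.pE 0 := by
      refine mul_mem_pE' (k := -k) ?_ (unif_zpow_mem_pE _) (by omega)
      rw [eq_inv_of_mul_eq_one_left r3, hcol, ← map_inv₀]
      exact conj_mem_pE hinv
    rw [U.memK, hm, hasPat_KPat]
    simp only [Matrix.diagonal_apply_eq]
    simp only [Matrix.diagonal_apply, Matrix.cons_val_zero, Matrix.cons_val_one, Matrix.cons_val]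
    rw [zpow_neg] at p0
    simp [zero_mem_pE, p0, p1, p2]
  refine ⟨l * t⁻¹ * (t * S.alphaE ^ k), C.K.mul_mem hl' ht', u, huK, -k, ?_⟩
  rw [hlu]
  group

/-- The Cartan decomposition. -/
lemma cartan (g : S.GG) : ∃ k₁ ∈ C.K, ∃ k₂ ∈ C.K, ∃ n : ℤ, g = k₁ * S.alphaE ^ n * k₂ := by
  have hβ := U.β_mem_K
  have hββ := U.β_mul_β
  have hex : ∃ k, U.Corner k g := by
    have key : ∀ x : S.E, ∃ n : ℤ, x ∈ S.pE n := by
      intro x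
      by_cases hx : x = 0
      · exact ⟨0, hx ▸ zero_mem_pE _⟩
      · obtain ⟨n, hn, -⟩ := exists_val hx
        exact ⟨n, hn⟩
    obtain ⟨n1, h1⟩ := key (S.mat g 0 0)
    obtain ⟨n2, h2⟩ := key (S.mat g 0 2)
    obtain ⟨n3, h3⟩ := key (S.mat g 2 0)
    obtain ⟨n4, h4⟩ := key (S.mat g 2 2)
    refine ⟨min (min n1 (n2 + ε)) (min (n3 - ε) n4), pE_anti (by omega) h1, pE_anti (by omega) h2,
      pE_anti (by omega) h3, pE_anti (by omega) h4⟩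
  by_cases hst : ∀ k, U.Corner k g → U.Corner (k + 1) g
  · obtain ⟨k, hk⟩ := hex
    have hall : ∀ n, k ≤ n → U.Corner n g := fun n hn =>
      Int.leInduction hk (fun m _ hm => hst m hm) n hn
    obtain ⟨a, b, c, d⟩ := hall (max k 0) (le_max_left _ _)
    have h0 : U.Corner 0 g := ⟨pE_anti (by omega) a, pE_anti (by omega) b, pE_anti (by omega) c,
      pE_anti (by omega) d⟩
    exact ⟨g, Corner.mem_K U h0, 1, C.K.one_mem, 0, by group⟩
  · push Not at hst
    obtain ⟨k, hk, hk'⟩ := hst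
    have sh : ∀ {x : S.E} {r s : ℤ}, S.ϖ ^ r * x ∈ S.pE s → x ∈ S.pE (s - r) := by
      intro x r s h
      have := mul_mem_pE (unif_zpow_mem_pE (-r)) h
      rw [← mul_assoc, ← zpow_add₀ S.unif_ne, neg_add_cancel, zpow_zero, one_mul] at this
      exact pE_anti (by omega) this
    by_cases h1 : S.mat g 0 0 ∈ S.pE (k + 1)
    swap
    · exact Corner.cartan U hk h1
    by_cases h2 : S.mat (C.βK * g) 0 0 ∈ S.pE (k + 1)
    swap
    · obtain ⟨k₁, hk₁, k₂, hk₂, n, h⟩ := Corner.cartan U (Corner.β_mul U hk) h2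
      refine ⟨C.βK * k₁, C.K.mul_mem hβ hk₁, k₂, hk₂, n, ?_⟩
      rw [mul_assoc, mul_assoc, ← mul_assoc k₁, ← h, ← mul_assoc, hββ, one_mul]
    by_cases h3 : S.mat (g * C.βK) 0 0 ∈ S.pE (k + 1)
    swap
    · obtain ⟨k₁, hk₁, k₂, hk₂, n, h⟩ := Corner.cartan U (Corner.mul_β U hk) h3
      refine ⟨k₁, hk₁, k₂ * C.βK, C.K.mul_mem hk₂ hβ, n, ?_⟩
      rw [← mul_assoc, ← h, mul_assoc, hββ, mul_one]
    by_cases h4 : S.mat (C.βK * g * C.βK) 0 0 ∈ S.pE (k + 1)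
    swap
    · obtain ⟨k₁, hk₁, k₂, hk₂, n, h⟩ :=
        Corner.cartan U (Corner.mul_β U (Corner.β_mul U hk)) h4
      refine ⟨C.βK * k₁, C.K.mul_mem hβ hk₁, k₂ * C.βK, C.K.mul_mem hk₂ hβ, n, ?_⟩
      rw [show C.βK * k₁ * S.alphaE ^ n * (k₂ * C.βK) = C.βK * (k₁ * S.alphaE ^ n * k₂) * C.βK by
        group, ← h, ← mul_assoc, ← mul_assoc, hββ, one_mul, mul_assoc, hββ, mul_one]
    refine absurd ⟨h1, ?_, ?_, ?_⟩ hk'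
    · rw [(U.mat_mul_β _ _).1, mul_comm] at h3
      exact sh h3
    · rw [(U.mat_β_mul _ _).1] at h2
      exact pE_anti (by omega) (sh h2)
    · rw [(U.mat_mul_β _ _).1, (U.mat_β_mul _ _).1, mul_assoc, mul_comm (S.mat g 2 2)] at h4
      exact pE_anti (by omega) (sh (sh h4))

end Uniform

end Setting

section Steinberg

open Setting

variable {S : Setting} {C : Chamber S} {ε : ℤ} {𝔽 : Type} [Field 𝔽]

lemma two_ne_zero_of_algebra [Algebra (ZMod S.p) 𝔽] : (2 : 𝔽) ≠ 0 := by
  have : Fact S.p.Prime := ⟨S.hp⟩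
  have : CharP 𝔽 S.p := charP_of_injective_algebraMap (algebraMap (ZMod S.p) 𝔽).injective S.p
  refine Ring.two_ne_zero ?_
  rw [ringChar.eq 𝔽 S.p]
  exact S.hodd

lemma PS1sub_left (U : Uniform C ε) {f : ↥C.K → 𝔽} (hf : f ∈ PS1sub C 𝔽) {b : ↥C.K}
    (hb : (b : S.GG) ∈ C.IK) (x : ↥C.K) : f (b * x) = f x := by
  obtain ⟨h, hh, i, hi, e⟩ := U.IK_decomp hb
  have hb' : b = ⟨h, U.IK_sub_K hh.2⟩ * ⟨i, U.I1_sub_K hi⟩ := Subtype.ext e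
  rw [hb', mul_assoc, hf.2.1 _ hh, hf.1 _ hi, one_mul]

lemma PSact_mem (U : Uniform C ε) {f : ↥C.K → 𝔽} (hf : f ∈ PS1sub C 𝔽) (k : ↥C.K) :
    PSact C 𝔽 k f ∈ PS1sub C 𝔽 := by
  refine ⟨fun b hb x => ?_, fun h hh x => ?_, fun z hz x => ?_⟩
  · simp only [PSact, mul_assoc]
    exact hf.1 b hb _
  · simp only [PSact, mul_assoc]
    exact hf.2.1 h hh _
  · have := hf.2.2 (k⁻¹ * z * k) (U.conj_Kone k.2 hz) (x * k)
    simp only [PSact]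
    rw [← this]
    congr 1
    group

lemma const_mem_PS1sub (c : 𝔽) : (fun _ => c) ∈ PS1sub C 𝔽 :=
  ⟨fun _ _ _ => rfl, fun _ _ _ => (one_mul c).symm, fun _ _ _ => rfl⟩

lemma PS1sub_eq_ite (U : Uniform C ε) {f : ↥C.K → 𝔽} (hf : f ∈ PS1sub C 𝔽)
    (hup : ∀ u : ↥C.K, IsUp (u : S.GG) → ∀ x, f (x * u) = f x) (k : ↥C.K) :
    f k = if (k : S.GG) ∈ C.IK then f 1 else f ⟨C.βK, U.β_mem_K⟩ := by
  split_ifs with hk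
  · rw [← PS1sub_left U hf hk 1, mul_one]
  have hββ := U.β_mul_β
  obtain ⟨l, hl, hlow, ⟨u, hu, hup', e⟩ | ⟨u, hu, e⟩⟩ := U.bruhat (C.K.mul_mem U.β_mem_K k.2)
  · have h1 := U.β_conj_lower hl hlow
    have hk' : k = ⟨C.βK * l * C.βK, U.IK_sub_K h1⟩ * (⟨C.βK, U.β_mem_K⟩ * ⟨u, hu⟩) := by
      apply Subtype.ext
      calc (k : S.GG) = C.βK * C.βK * k := by rw [hββ, one_mul]
        _ = C.βK * l * 1 * u := by rw [mul_assoc, e]; group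
        _ = _ := by rw [← hββ]; simp only [Subgroup.coe_mul, mul_assoc]
    rw [hk', PS1sub_left U hf h1, hup _ hup']
  · refine absurd ?_ hk
    have hk' : (k : S.GG) = C.βK * l * C.βK * u := by
      calc (k : S.GG) = C.βK * C.βK * k := by rw [hββ, one_mul]
        _ = _ := by rw [mul_assoc, e]; group
    rw [hk']
    exact U.IK_mul (U.β_conj_lower hl hlow) (U.I1_sub_IK hu)

variable {W : Type} [AddCommGroup W] [Module 𝔽 W] {σ : Representation 𝔽 ↥C.K W}

/-- In the Steinberg weight, a vector fixed by the upper unipotent elements is the image of a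
multiple of the indicator function of the Iwahori subgroup. -/
lemma exists_indicator (U : Uniform C ε) {φ : ↥(PS1sub C 𝔽) →ₗ[𝔽] W} (hs : Function.Surjective φ)
    (hker : ∀ f : ↥(PS1sub C 𝔽), φ f = 0 ↔ ∃ c : 𝔽, (f : ↥C.K → 𝔽) = fun _ => c)
    (hφ : ∀ (k : ↥C.K) (f f' : ↥(PS1sub C 𝔽)),
      (f' : ↥C.K → 𝔽) = PSact C 𝔽 k (f : ↥C.K → 𝔽) → φ f' = σ k (φ f))
    {w : W} (hw : ∀ u : ↥C.K, IsUp (u : S.GG) → σ u w = w) :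
    ∃ (a : 𝔽) (f : ↥(PS1sub C 𝔽)), φ f = w ∧
      ∀ k : ↥C.K, (f : ↥C.K → 𝔽) k = if (k : S.GG) ∈ C.IK then a else 0 := by
  obtain ⟨f, rfl⟩ := hs w
  have hup : ∀ u : ↥C.K, IsUp (u : S.GG) → ∀ x, (f : ↥C.K → 𝔽) (x * u) = (f : ↥C.K → 𝔽) x := by
    intro u hu x
    have h1 := hφ u f ⟨_, PSact_mem U f.2 u⟩ rfl
    rw [hw u hu, ← sub_eq_zero, ← map_sub, hker] at h1
    obtain ⟨c, hc⟩ := h1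
    have hx := congrFun hc x
    have h1 := congrFun hc 1
    have h2 := PS1sub_left U f.2 (U.I1_sub_IK (U.up_mem_I1 u.2 hu)) 1
    simp only [Submodule.coe_sub, Pi.sub_apply, PSact] at hx h1
    rw [mul_one] at h2
    rw [one_mul, h2, sub_self] at h1
    rwa [← h1, sub_eq_zero] at hx
  set b := (f : ↥C.K → 𝔽) ⟨C.βK, U.β_mem_K⟩ with hb
  refine ⟨(f : ↥C.K → 𝔽) 1 - b, f - ⟨_, const_mem_PS1sub b⟩, ?_, fun k => ?_⟩
  · rw [map_sub, (hker ⟨_, const_mem_PS1sub b⟩).2 ⟨b, rfl⟩, sub_zero]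
  · simp only [Submodule.coe_sub, Pi.sub_apply]
    rw [PS1sub_eq_ite U f.2 hup k]
    split_ifs <;> simp [hb]

lemma IsSteinberg.IK_fixed (hst : IsSteinberg C 𝔽 σ) (U : Uniform C ε) {w : W}
    (hw : ∀ u : ↥C.K, IsUp (u : S.GG) → σ u w = w) {i : ↥C.K} (hi : (i : S.GG) ∈ C.IK) :
    σ i w = w := by
  obtain ⟨φ, hs, hker, hφ⟩ := hst
  obtain ⟨a, f, rfl, hf⟩ := exists_indicator U hs hker hφ hw
  refine (hφ i f f ?_).symm
  funext x
  rw [PSact, hf, hf]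
  have : (x : S.GG) ∈ C.IK ↔ ((x * i : ↥C.K) : S.GG) ∈ C.IK :=
    ⟨fun h => U.IK_mul h hi, fun h => by simpa using U.IK_mul h (U.IK_inv hi)⟩
  simp only [this]

lemma IsSteinberg.exists_smul (hst : IsSteinberg C 𝔽 σ) (U : Uniform C ε) {v w : W} (hv0 : v ≠ 0)
    (hv : ∀ u : ↥C.K, IsUp (u : S.GG) → σ u v = v)
    (hw : ∀ u : ↥C.K, IsUp (u : S.GG) → σ u w = w) : ∃ c : 𝔽, w = c • v := by
  obtain ⟨φ, hs, hker, hφ⟩ := hst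
  obtain ⟨a, f, rfl, hf⟩ := exists_indicator U hs hker hφ hv
  obtain ⟨b, g, rfl, hg⟩ := exists_indicator U hs hker hφ hw
  have ha : a ≠ 0 := by
    rintro rfl
    exact hv0 ((hker f).2 ⟨0, funext fun k => by simp [hf]⟩)
  refine ⟨b / a, ?_⟩
  rw [← map_smul]
  congr 1
  refine Subtype.ext (funext fun k => ?_)
  rw [hg, Submodule.coe_smul, Pi.smul_apply, hf]
  split_ifs <;> simp [ha]

lemma IsSteinberg.eq_zero_of_fixed (hst : IsSteinberg C 𝔽 σ) (U : Uniform C ε)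
    (h2 : (2 : 𝔽) ≠ 0) {w : W} (hw : ∀ k : ↥C.K, σ k w = w) : w = 0 := by
  obtain ⟨φ, hs, hker, hφ⟩ := hst
  obtain ⟨a, f, rfl, hf⟩ := exists_indicator U hs hker hφ fun u _ => hw u
  have h1 := hφ ⟨C.βK, U.β_mem_K⟩ f ⟨_, PSact_mem U f.2 _⟩ rfl
  rw [hw, ← sub_eq_zero, ← map_sub, hker] at h1
  obtain ⟨c, hc⟩ := h1
  have e1 := congrFun hc 1
  have e2 := congrFun hc ⟨C.βK, U.β_mem_K⟩
  simp only [Submodule.coe_sub, Pi.sub_apply, PSact, hf, Subgroup.coe_mul, U.β_mul_β,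
    U.one_mem_IK, U.β_notMem_IK, Subgroup.coe_one, one_mul, if_true, if_false] at e1 e2
  have ha : a = 0 := by
    have : 2 * a = 0 := by linear_combination e2 - e1
    simpa [h2] using this
  exact (hker f).2 ⟨0, funext fun k => by simp [hf, ha]⟩

end Steinberg

section Frobenius

variable {S : Setting} {C : Chamber S} {𝔽 : Type} [Field 𝔽]
  {W : Type} [AddCommGroup W] [Module 𝔽 W] {σ : Representation 𝔽 ↥C.K W}

lemma indRep_apply (f : ↥(IndSub C 𝔽 W σ)) (g x : S.GG) :
    (indRep C 𝔽 W σ g f : S.GG → W) x = (f : S.GG → W) (x * g) := rfl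

lemma ind_mul (f : ↥(IndSub C 𝔽 W σ)) {k : S.GG} (hk : k ∈ C.K) (g : S.GG) :
    (f : S.GG → W) (k * g) = σ ⟨k, hk⟩ ((f : S.GG → W) g) := f.2.1 k hk g

variable (C) in
/-- The set of cosets `K \ G`. -/
abbrev Cosets : Type := Quotient (QuotientGroup.rightRel C.K)

lemma mk_eq_mk {x y : S.GG} : (⟦x⟧ : Cosets C) = ⟦y⟧ ↔ y * x⁻¹ ∈ C.K := by
  rw [Quotient.eq, QuotientGroup.rightRel_apply]

lemma mul_inv_out_mem (x : S.GG) : x * (Quotient.out (⟦x⟧ : Cosets C))⁻¹ ∈ C.K :=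
  mk_eq_mk.1 (Quotient.out_eq _)

lemma finite_support_out (f : ↥(IndSub C 𝔽 W σ)) :
    {q : Cosets C | (f : S.GG → W) q.out ≠ 0}.Finite := by
  obtain ⟨s, hs⟩ := f.2.2
  refine (s.finite_toSet.image (Quotient.mk _)).subset fun q hq => ?_
  obtain ⟨k, hk, t, ht, e⟩ := hs _ hq
  refine ⟨t, ht, ?_⟩
  rw [← Quotient.out_eq q, mk_eq_mk, e]
  simpa using hk

variable {f₀ : ↥(IndSub C 𝔽 𝔽 (1 : Representation 𝔽 ↥C.K 𝔽))} {c : 𝔽}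

lemma ind_trivial_mul (f : ↥(IndSub C 𝔽 𝔽 (1 : Representation 𝔽 ↥C.K 𝔽))) {k : S.GG}
    (hk : k ∈ C.K) (g : S.GG) : (f : S.GG → 𝔽) (k * g) = (f : S.GG → 𝔽) g := ind_mul f hk g

lemma ind_trivial_expand (hc : c ≠ 0)
    (h₀ : ∀ x, (f₀ : S.GG → 𝔽) x = if x ∈ C.K then c else 0)
    (f : ↥(IndSub C 𝔽 𝔽 (1 : Representation 𝔽 ↥C.K 𝔽))) :
    f = ∑ q ∈ (finite_support_out f).toFinset, (c⁻¹ * (f : S.GG → 𝔽) q.out) •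
      indRep C 𝔽 𝔽 (1 : Representation 𝔽 ↥C.K 𝔽) q.out⁻¹ f₀ := by
  refine Subtype.ext (funext fun x => ?_)
  have hx : (f : S.GG → 𝔽) (Quotient.out (⟦x⟧ : Cosets C)) = (f : S.GG → 𝔽) x := by
    rw [← ind_trivial_mul f (mul_inv_out_mem x), inv_mul_cancel_right]
  simp only [Submodule.coe_sum, Finset.sum_apply, Submodule.coe_smul, Pi.smul_apply, smul_eq_mul,
    indRep_apply, h₀]
  rw [Finset.sum_eq_single (⟦x⟧ : Cosets C)]
  · rw [if_pos (mul_inv_out_mem x), hx]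
    field_simp
  · intro q _ hq
    rw [if_neg, mul_zero]
    intro h
    apply hq
    rwa [← Quotient.out_eq q, mk_eq_mk]
  · intro h
    have : (f : S.GG → 𝔽) (Quotient.out (⟦x⟧ : Cosets C)) = 0 := by simpa using h
    rw [this, mul_zero, zero_mul]

variable {V : Type} [AddCommGroup V] [Module 𝔽 V] {ρ : Representation 𝔽 S.GG V}

lemma finite_support_frobenius (w : V) (c : 𝔽)
    (f : ↥(IndSub C 𝔽 𝔽 (1 : Representation 𝔽 ↥C.K 𝔽))) :
    (Function.support fun q : Cosets C =>
      (c * (f : S.GG → 𝔽) q.out) • ρ q.out⁻¹ w).Finite := by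
  refine (finite_support_out f).subset fun q hq => ?_
  intro h
  apply hq
  simp [h]

/-- The linear map `ind_K^G 1 → V` attached to a `K`-invariant vector `w` of `V`. -/
def frobeniusMap (ρ : Representation 𝔽 S.GG V) (w : V) (c : 𝔽) :
    ↥(IndSub C 𝔽 𝔽 (1 : Representation 𝔽 ↥C.K 𝔽)) →ₗ[𝔽] V where
  toFun f := ∑ᶠ q : Cosets C, (c * (f : S.GG → 𝔽) q.out) • ρ q.out⁻¹ w
  map_add' f g := by
    rw [← finsum_add_distrib (finite_support_frobenius w c f) (finite_support_frobenius w c g)]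
    simp [mul_add, add_smul]
  map_smul' a f := by
    rw [RingHom.id_apply, smul_finsum' _ (finite_support_frobenius w c f)]
    simp [smul_smul, mul_left_comm]

lemma frobenius_term_eq {w : V} (hw : w ∈ invariantsOn 𝔽 ρ C.K) (c : 𝔽)
    (f : ↥(IndSub C 𝔽 𝔽 (1 : Representation 𝔽 ↥C.K 𝔽))) (x : S.GG) :
    (c * (f : S.GG → 𝔽) (Quotient.out (⟦x⟧ : Cosets C))) •
      ρ (Quotient.out (⟦x⟧ : Cosets C))⁻¹ w = (c * (f : S.GG → 𝔽) x) • ρ x⁻¹ w := by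
  have h := mul_inv_out_mem (C := C) x
  generalize Quotient.out (⟦x⟧ : Cosets C) = y at h ⊢
  obtain ⟨k, hk, rfl⟩ : ∃ k ∈ C.K, x = k * y := ⟨_, h, by group⟩
  rw [ind_trivial_mul f hk, mul_inv_rev, map_mul, Module.End.mul_apply,
    hw _ (C.K.inv_mem hk)]

/-- Right translation on the set of cosets `K \ G`. -/
def cosetsMul (g : S.GG) : Cosets C ≃ Cosets C where
  toFun := Quotient.map (· * g) fun x y h => by
    rw [← Quotient.eq_iff_equiv, mk_eq_mk] at h ⊢
    simpa [mul_assoc] using h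
  invFun := Quotient.map (· * g⁻¹) fun x y h => by
    rw [← Quotient.eq_iff_equiv, mk_eq_mk] at h ⊢
    simpa [mul_assoc] using h
  left_inv := by rintro ⟨x⟩; exact congrArg (Quotient.mk _) (mul_inv_cancel_right x g)
  right_inv := by rintro ⟨x⟩; exact congrArg (Quotient.mk _) (inv_mul_cancel_right x g)

lemma frobeniusMap_mem {w : V} (hw : w ∈ invariantsOn 𝔽 ρ C.K) (c : 𝔽) :
    frobeniusMap ρ w c ∈
      EquivHomSub 𝔽 (indRep C 𝔽 𝔽 (1 : Representation 𝔽 ↥C.K 𝔽)) ρ := by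
  intro g f
  simp only [frobeniusMap, LinearMap.coe_mk, AddHom.coe_mk]
  have e := (ρ g).toAddMonoidHom.map_finsum (finite_support_frobenius (ρ := ρ) w c f)
  simp only [LinearMap.toAddMonoidHom_coe] at e
  rw [e]
  refine (finsum_congr fun q => ?_).trans (finsum_comp_equiv (cosetsMul g))
  obtain ⟨x, rfl⟩ := Quotient.exists_rep q
  have h : cosetsMul g (⟦x⟧ : Cosets C) = ⟦x * g⟧ := rfl
  rw [frobenius_term_eq hw, h, frobenius_term_eq hw, map_smul, indRep_apply, mul_inv_rev, map_mul,
    Module.End.mul_apply, ← Module.End.mul_apply, ← map_mul, mul_inv_cancel, map_one,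
    Module.End.one_apply]

lemma frobeniusMap_apply (hc : c ≠ 0)
    (h₀ : ∀ x, (f₀ : S.GG → 𝔽) x = if x ∈ C.K then c else 0) {w : V}
    (hw : w ∈ invariantsOn 𝔽 ρ C.K) : frobeniusMap ρ w c⁻¹ f₀ = w := by
  simp only [frobeniusMap, LinearMap.coe_mk, AddHom.coe_mk]
  rw [finsum_eq_single _ (⟦1⟧ : Cosets C), frobenius_term_eq hw, h₀, if_pos C.K.one_mem, inv_one,
    map_one, inv_mul_cancel₀ hc, one_smul, Module.End.one_apply]
  intro q hq
  rw [h₀, if_neg, mul_zero, zero_smul]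
  intro h
  apply hq
  rw [← Quotient.out_eq q, mk_eq_mk]
  simpa using h

/-- Frobenius reciprocity for the compact induction of the trivial representation. -/
theorem exists_frobenius_equiv (hc : c ≠ 0)
    (h₀ : ∀ x, (f₀ : S.GG → 𝔽) x = if x ∈ C.K then c else 0) :
    ∃ e : ↥(EquivHomSub 𝔽 (indRep C 𝔽 𝔽 (1 : Representation 𝔽 ↥C.K 𝔽)) ρ) ≃ₗ[𝔽]
        ↥(invariantsOn 𝔽 ρ (C.K : Set S.GG)),
      ∀ φ, (e φ : V) =
        (φ : ↥(IndSub C 𝔽 𝔽 (1 : Representation 𝔽 ↥C.K 𝔽)) →ₗ[𝔽] V) f₀ := by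
  have hinv : ∀ k ∈ C.K, indRep C 𝔽 𝔽 (1 : Representation 𝔽 ↥C.K 𝔽) k f₀ = f₀ := fun k hk =>
    Subtype.ext (funext fun x => by simp only [indRep_apply, h₀, C.K.mul_mem_cancel_right hk])
  let ev : ↥(EquivHomSub 𝔽 (indRep C 𝔽 𝔽 (1 : Representation 𝔽 ↥C.K 𝔽)) ρ) →ₗ[𝔽]
      ↥(invariantsOn 𝔽 ρ (C.K : Set S.GG)) :=
    { toFun := fun φ => ⟨φ.1 f₀, fun k hk => by rw [← φ.2, hinv k hk]⟩
      map_add' := fun _ _ => rfl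
      map_smul' := fun _ _ => rfl }
  refine ⟨LinearEquiv.ofBijective ev ⟨?_, fun w => ?_⟩, fun φ => rfl⟩
  · rw [← LinearMap.ker_eq_bot, LinearMap.ker_eq_bot']
    intro φ hφ
    have h0 : φ.1 f₀ = 0 := congrArg Subtype.val hφ
    refine Subtype.ext (LinearMap.ext fun f => ?_)
    rw [ind_trivial_expand hc h₀ f, map_sum]
    refine Finset.sum_eq_zero fun q _ => ?_
    rw [map_smul, φ.2, h0, map_zero, smul_zero]
  · exact ⟨⟨_, frobeniusMap_mem w.2 c⁻¹⟩, Subtype.ext (frobeniusMap_apply hc h₀ w.2)⟩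

end Frobenius

section Main

open Setting

variable {S : Setting} {C : Chamber S} {ε : ℤ} {𝔽 : Type} [Field 𝔽]
  {W : Type} [AddCommGroup W] [Module 𝔽 W] {σ : Representation 𝔽 ↥C.K W}

lemma sigma'_of_mem {k : S.GG} (hk : k ∈ C.K) : sigma' C 𝔽 W σ k = σ ⟨k, hk⟩ := dif_pos hk

lemma alpha_mul_β (U : Uniform C ε) (n : ℤ) :
    S.alphaE ^ n * C.βK = C.βK * S.alphaE ^ (-n) := by
  rw [U.alpha_neg, ← mul_assoc, ← mul_assoc, U.β_mul_β, one_mul]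

lemma IsFFamily.zero_apply (U : Uniform C ε) {v : 𝔽}
    {ff : ℤ → ↥(IndSub C 𝔽 𝔽 (1 : Representation 𝔽 ↥C.K 𝔽))}
    (h : IsFFamily C 𝔽 𝔽 (1 : Representation 𝔽 ↥C.K 𝔽) v ff) (x : S.GG) :
    (ff 0 : S.GG → 𝔽) x = if x ∈ C.K then v else 0 := by
  obtain ⟨-, -, -, hsupp, -, hval⟩ := h
  split_ifs with hx
  · rw [← mul_one x, ind_trivial_mul _ hx]
    simpa using hval 0 le_rfl
  · by_contra hne
    obtain ⟨k, hk, i, hi, rfl⟩ := hsupp 0 x hne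
    apply hx
    simpa using C.K.mul_mem hk (U.I1_sub_K hi)

section Family

variable {v : W} {ff : ℤ → ↥(IndSub C 𝔽 W σ)}

lemma IsFFamily.up_fixed (U : Uniform C ε) (h : IsFFamily C 𝔽 W σ v ff) (u : ↥C.K)
    (hu : IsUp (u : S.GG)) : σ u v = v := by
  have := h.2.1 u (U.up_mem_I1 u.2 hu)
  rwa [sigma'_of_mem u.2] at this

lemma IsFFamily.apply_eq_zero (U : Uniform C ε) (h : IsFFamily C 𝔽 W σ v ff) {m n : ℤ}
    (hmn : -m ≠ n) : (ff m : S.GG → W) (S.alphaE ^ n) = 0 := by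
  by_contra hne
  obtain ⟨k, hk, i, hi, e⟩ := h.2.2.2.1 m _ hne
  exact hmn (U.alpha_eq hk hi e)

lemma IsFFamily.add_apply (U : Uniform C ε) (h : IsFFamily C 𝔽 W σ v ff) {m n : ℤ} (hm : 0 ≤ m)
    (hn : 1 ≤ n) : ((ff n + ff (-n) : ↥(IndSub C 𝔽 W σ)) : S.GG → W) (S.alphaE ^ m) =
      if n = m then v else 0 := by
  rw [Submodule.coe_add, Pi.add_apply, h.apply_eq_zero U (by omega), zero_add]
  split_ifs with e
  · have := h.2.2.2.2.2 (-n) (by omega)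
    rw [neg_neg] at this
    rwa [← e]
  · exact h.apply_eq_zero U (by omega)

lemma IsFFamily.add_apply_neg (U : Uniform C ε) (h : IsFFamily C 𝔽 W σ v ff) {n : ℤ}
    (hn : 1 ≤ n) : ((ff n + ff (-n) : ↥(IndSub C 𝔽 W σ)) : S.GG → W) (S.alphaE ^ (-n)) =
      σ ⟨C.βK, U.β_mem_K⟩ v := by
  rw [Submodule.coe_add, Pi.add_apply, h.apply_eq_zero U (m := -n) (by omega), add_zero,
    h.2.2.2.2.1 n (by omega), sigma'_of_mem U.β_mem_K]

lemma β_sq_apply (U : Uniform C ε) (v : W) :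
    σ ⟨C.βK, U.β_mem_K⟩ (σ ⟨C.βK, U.β_mem_K⟩ v) = v := by
  have : (⟨C.βK, U.β_mem_K⟩ * ⟨C.βK, U.β_mem_K⟩ : ↥C.K) = 1 := Subtype.ext U.β_mul_β
  rw [← Module.End.mul_apply, ← map_mul, this, map_one, Module.End.one_apply]

lemma IsFFamily.add_apply_mul (U : Uniform C ε) (hst : IsSteinberg C 𝔽 σ)
    (h : IsFFamily C 𝔽 W σ v ff) {n : ℤ} (hn : 1 ≤ n) {k : S.GG} (hk : k ∈ C.K) :
    ((ff n + ff (-n) : ↥(IndSub C 𝔽 W σ)) : S.GG → W) (S.alphaE ^ n * k) = v := by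
  have hIK : ∀ i : ↥C.K, (i : S.GG) ∈ C.IK → σ i v = v :=
    fun i hi => hst.IK_fixed U (h.up_fixed U) hi
  have hα := h.add_apply U (m := n) (by omega) hn
  have hα' := h.add_apply_neg U hn
  have hI1 : ∀ i ∈ C.I1, ∀ x, ((ff n + ff (-n) : ↥(IndSub C 𝔽 W σ)) : S.GG → W) (x * i) =
      ((ff n + ff (-n) : ↥(IndSub C 𝔽 W σ)) : S.GG → W) x := by
    intro i hi x
    rw [← indRep_apply, map_add, h.2.2.1 _ i hi, h.2.2.1 _ i hi]
  generalize ff n + ff (-n) = s at *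
  rw [if_pos rfl] at hα
  obtain ⟨l, hl, hlow, ⟨u, hu, hup, rfl⟩ | ⟨u, hu, rfl⟩⟩ := U.bruhat hk
  · have hl' := U.alpha_conj_lower hl hlow hn
    have e : S.alphaE ^ n * (l * u) =
        S.alphaE ^ n * l * S.alphaE ^ (-n) * S.alphaE ^ n * u := by group
    rw [e, hI1 u (U.up_mem_I1 hu hup), ind_mul s (U.IK_sub_K hl'), hα, hIK _ hl']
  · have hl' := U.alpha_conj_lower hl hlow hn
    have e : S.alphaE ^ n * (l * C.βK * u) =
        S.alphaE ^ n * l * S.alphaE ^ (-n) * (S.alphaE ^ n * C.βK) * u := by group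
    rw [e, hI1 u hu, ind_mul s (U.IK_sub_K hl'), alpha_mul_β U, ind_mul s U.β_mem_K, hα',
      β_sq_apply U, hIK _ hl']

lemma IsFFamily.add_support (U : Uniform C ε) (h : IsFFamily C 𝔽 W σ v ff) {n : ℤ} {x : S.GG}
    (hx : ((ff n + ff (-n) : ↥(IndSub C 𝔽 W σ)) : S.GG → W) x ≠ 0) :
    ∃ k₁ ∈ C.K, ∃ k₂ ∈ C.K, x = k₁ * (S.alphaE ^ n * k₂) := by
  rw [Submodule.coe_add, Pi.add_apply] at hx
  have hβ := U.β_mem_K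
  by_cases h1 : (ff n : S.GG → W) x = 0
  · rw [h1, zero_add] at hx
    obtain ⟨k, hk, i, hi, rfl⟩ := h.2.2.2.1 _ x hx
    exact ⟨k, hk, i, U.I1_sub_K hi, by rw [neg_neg, mul_assoc]⟩
  · obtain ⟨k, hk, i, hi, rfl⟩ := h.2.2.2.1 _ x h1
    exact ⟨k * C.βK, C.K.mul_mem hk hβ, C.βK * i, C.K.mul_mem hβ (U.I1_sub_K hi),
      by rw [U.alpha_neg]; group⟩

lemma IsFFamily.add_mem_invariantsOn (U : Uniform C ε) (hst : IsSteinberg C 𝔽 σ)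
    (h : IsFFamily C 𝔽 W σ v ff) {n : ℤ} (hn : 1 ≤ n) :
    ff n + ff (-n) ∈ invariantsOn 𝔽 (indRep C 𝔽 W σ) (C.K : Set S.GG) := by
  intro k hk
  refine Subtype.ext (funext fun x => ?_)
  rw [indRep_apply]
  by_cases hx : ∃ k₁ ∈ C.K, ∃ k₂ ∈ C.K, x = k₁ * (S.alphaE ^ n * k₂)
  · obtain ⟨k₁, hk₁, k₂, hk₂, rfl⟩ := hx
    rw [mul_assoc, mul_assoc, ind_mul _ hk₁, ind_mul _ hk₁,
      h.add_apply_mul U hst hn (C.K.mul_mem hk₂ hk), h.add_apply_mul U hst hn hk₂]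
  · have h1 : ((ff n + ff (-n) : ↥(IndSub C 𝔽 W σ)) : S.GG → W) x = 0 := by
      by_contra hne
      exact hx (h.add_support U hne)
    have h2 : ((ff n + ff (-n) : ↥(IndSub C 𝔽 W σ)) : S.GG → W) (x * k) = 0 := by
      by_contra hne
      obtain ⟨k₁, hk₁, k₂, hk₂, e⟩ := h.add_support U hne
      exact hx ⟨k₁, hk₁, k₂ * k⁻¹, C.K.mul_mem hk₂ (C.K.inv_mem hk), by
        rw [← mul_inv_cancel_right x k, e]; group⟩
    rw [h1, h2]

end Family

lemma apply_mul_of_mem_invariantsOn {f : ↥(IndSub C 𝔽 W σ)}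
    (hf : f ∈ invariantsOn 𝔽 (indRep C 𝔽 W σ) (C.K : Set S.GG)) {k : S.GG} (hk : k ∈ C.K)
    (x : S.GG) : (f : S.GG → W) (x * k) = (f : S.GG → W) x := by
  rw [← indRep_apply, hf k hk]

/-- A `K`-invariant element of `ind_K^G σ` is determined by its values at the `α ^ n`, `n ≥ 0`. -/
lemma eq_zero_of_mem_invariantsOn (U : Uniform C ε) {f : ↥(IndSub C 𝔽 W σ)}
    (hf : f ∈ invariantsOn 𝔽 (indRep C 𝔽 W σ) (C.K : Set S.GG))
    (h : ∀ n : ℤ, 0 ≤ n → (f : S.GG → W) (S.alphaE ^ n) = 0) : f = 0 := by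
  refine Subtype.ext (funext fun x => ?_)
  obtain ⟨k₁, hk₁, k₂, hk₂, n, rfl⟩ := U.cartan x
  rw [apply_mul_of_mem_invariantsOn hf hk₂, ind_mul _ hk₁]
  have hn : (f : S.GG → W) (S.alphaE ^ n) = 0 := by
    rcases le_total 0 n with hn | hn
    · exact h n hn
    · rw [← neg_neg n, U.alpha_neg, apply_mul_of_mem_invariantsOn hf U.β_mem_K,
        ind_mul _ U.β_mem_K, h (-n) (by omega), map_zero]
  rw [hn, map_zero]
  rfl

lemma up_fixed_of_mem_invariantsOn (U : Uniform C ε) {f : ↥(IndSub C 𝔽 W σ)}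
    (hf : f ∈ invariantsOn 𝔽 (indRep C 𝔽 W σ) (C.K : Set S.GG)) {n : ℤ} (hn : 0 ≤ n) (u : ↥C.K)
    (hu : IsUp (u : S.GG)) :
    σ u ((f : S.GG → W) (S.alphaE ^ n)) = (f : S.GG → W) (S.alphaE ^ n) := by
  rw [← ind_mul f u.2,
    ← apply_mul_of_mem_invariantsOn hf (U.alpha_conj_up u.2 hu hn) (S.alphaE ^ n)]
  group

lemma apply_one_fixed_of_mem_invariantsOn {f : ↥(IndSub C 𝔽 W σ)}
    (hf : f ∈ invariantsOn 𝔽 (indRep C 𝔽 W σ) (C.K : Set S.GG)) (k : ↥C.K) :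
    σ k ((f : S.GG → W) 1) = (f : S.GG → W) 1 := by
  rw [← ind_mul f k.2, ← apply_mul_of_mem_invariantsOn hf k.2 1, mul_one, one_mul]

lemma finite_alpha_support (U : Uniform C ε) (f : ↥(IndSub C 𝔽 W σ)) :
    {n : {n : ℤ // 1 ≤ n} | (f : S.GG → W) (S.alphaE ^ (n : ℤ)) ≠ 0}.Finite := by
  obtain ⟨t, ht⟩ := f.2.2
  choose! k hk y hy e using fun n : ℤ => ht (S.alphaE ^ n)
  refine Set.Finite.of_injOn (f := fun n : {n : ℤ // 1 ≤ n} => y n) (t := (t : Set S.GG))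
    (fun n hn => hy n hn) (fun m hm n hn hmn => ?_) t.finite_toSet
  have hmn' : y m = y n := hmn
  refine Subtype.ext (U.alpha_eq (k := k n * (k m)⁻¹)
    (C.K.mul_mem (hk n hn) (C.K.inv_mem (hk m hm))) U.one_mem_I1 ?_)
  calc S.alphaE ^ (n : ℤ) = k n * y n := e n hn
    _ = k n * (k m)⁻¹ * (k m * y m) * 1 := by rw [hmn']; group
    _ = _ := by rw [← e m hm]

lemma IsFFamily.linearIndependent (U : Uniform C ε) {v : W} {ff : ℤ → ↥(IndSub C 𝔽 W σ)}
    (h : IsFFamily C 𝔽 W σ v ff) :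
    LinearIndependent 𝔽 fun n : {n : ℤ // 1 ≤ n} => ff n + ff (-(n : ℤ)) := by
  rw [linearIndependent_iff']
  intro t g hg i hi
  have := congrFun (congrArg Subtype.val hg) (S.alphaE ^ (i : ℤ))
  simp only [Submodule.coe_sum, Finset.sum_apply, Submodule.coe_smul, Pi.smul_apply] at this
  rw [Finset.sum_eq_single i, h.add_apply U (by have := i.2; omega) i.2, if_pos rfl] at this
  · exact (smul_eq_zero.1 this).resolve_right h.1
  · intro j _ hj
    rw [h.add_apply U (by have := i.2; omega) j.2, if_neg fun e => hj (Subtype.ext e), smul_zero]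
  · exact fun hi' => absurd hi hi'

theorem IsFFamily.span_eq (U : Uniform C ε) (hst : IsSteinberg C 𝔽 σ) (h2 : (2 : 𝔽) ≠ 0)
    {v : W} {ff : ℤ → ↥(IndSub C 𝔽 W σ)} (h : IsFFamily C 𝔽 W σ v ff) :
    Submodule.span 𝔽 (Set.range fun n : {n : ℤ // 1 ≤ n} => ff n + ff (-(n : ℤ))) =
      invariantsOn 𝔽 (indRep C 𝔽 W σ) (C.K : Set S.GG) := by
  apply le_antisymm
  · rw [Submodule.span_le]
    rintro _ ⟨n, rfl⟩
    exact h.add_mem_invariantsOn U hst n.2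
  intro f hf
  have hc : ∀ n : {n : ℤ // 1 ≤ n}, ∃ c : 𝔽, (f : S.GG → W) (S.alphaE ^ (n : ℤ)) = c • v :=
    fun n => hst.exists_smul U h.1 (h.up_fixed U)
      (up_fixed_of_mem_invariantsOn U hf (by have := n.2; omega))
  choose c hc using hc
  have hfin := finite_alpha_support U f
  set g := ∑ n ∈ hfin.toFinset, c n • (ff n + ff (-(n : ℤ))) with hg
  have hgspan : g ∈ Submodule.span 𝔽
      (Set.range fun n : {n : ℤ // 1 ≤ n} => ff n + ff (-(n : ℤ))) :=
    Submodule.sum_mem _ fun n _ => Submodule.smul_mem _ _ (Submodule.subset_span ⟨n, rfl⟩)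
  have hginv : g ∈ invariantsOn 𝔽 (indRep C 𝔽 W σ) (C.K : Set S.GG) :=
    Submodule.sum_mem _ fun n _ => Submodule.smul_mem _ _ (h.add_mem_invariantsOn U hst n.2)
  suffices hfg : f - g = 0 by rwa [sub_eq_zero.1 hfg]
  refine eq_zero_of_mem_invariantsOn U (Submodule.sub_mem _ hf hginv) fun m hm => ?_
  rw [Submodule.coe_sub, Pi.sub_apply, sub_eq_zero, hg]
  simp only [Submodule.coe_sum, Finset.sum_apply, Submodule.coe_smul, Pi.smul_apply]
  rcases hm.eq_or_lt with rfl | hm'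
  · rw [zpow_zero, hst.eq_zero_of_fixed U h2 (apply_one_fixed_of_mem_invariantsOn hf)]
    refine (Finset.sum_eq_zero fun n _ => ?_).symm
    rw [← zpow_zero S.alphaE, h.add_apply U le_rfl n.2, if_neg (by have := n.2; omega), smul_zero]
  · rw [Finset.sum_eq_single (⟨m, hm'⟩ : {n : ℤ // 1 ≤ n}), h.add_apply U hm hm', if_pos rfl]
    · exact hc ⟨m, hm'⟩
    · intro n _ hn
      rw [h.add_apply U hm n.2, if_neg fun e => hn (Subtype.ext e), smul_zero]
    · intro hm0
      rw [h.add_apply U hm hm', if_pos rfl, ← hc ⟨m, hm'⟩]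
      simpa using hm0

end Main

/-- `φ ↦ φ(f_{0,1})` is an isomorphism from
`Hom_G(ind_K^G 1, ind_K^G st)` onto `(ind_K^G st)^K`, and `{f_{n,st} + f_{-n,st} : n ≥ 1}`
is a basis of `(ind_K^G st)^K`. -/
theorem stmt11
    (S : Setting) (C : Chamber S)
    (𝔽 : Type) [Field 𝔽] [IsAlgClosed 𝔽] [Algebra (ZMod S.p) 𝔽]
    [Algebra.IsAlgebraic (ZMod S.p) 𝔽]
    (Wst : Type) [AddCommGroup Wst] [Module 𝔽 Wst]
    (σst : Representation 𝔽 ↥C.K Wst)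
    (hstweight : IsWeight C 𝔽 Wst σst) (hst : IsSteinberg C 𝔽 σst)
    (v0st : Wst) (ffst : ℤ → ↥(IndSub C 𝔽 Wst σst))
    (hffst : IsFFamily C 𝔽 Wst σst v0st ffst)
    (v0tr : 𝔽) (fftr : ℤ → ↥(IndSub C 𝔽 𝔽 (1 : Representation 𝔽 ↥C.K 𝔽)))
    (hfftr : IsFFamily C 𝔽 𝔽 (1 : Representation 𝔽 ↥C.K 𝔽) v0tr fftr) :
    (∃ e : ↥(EquivHomSub 𝔽 (indRep C 𝔽 𝔽 (1 : Representation 𝔽 ↥C.K 𝔽))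
            (indRep C 𝔽 Wst σst)) ≃ₗ[𝔽]
          ↥(invariantsOn 𝔽 (indRep C 𝔽 Wst σst) ↑C.K),
      ∀ φ, ((e φ : ↥(invariantsOn 𝔽 (indRep C 𝔽 Wst σst) ↑C.K)) : ↥(IndSub C 𝔽 Wst σst)) =
        (φ : ↥(IndSub C 𝔽 𝔽 (1 : Representation 𝔽 ↥C.K 𝔽)) →ₗ[𝔽]
          ↥(IndSub C 𝔽 Wst σst)) (fftr 0)) ∧
    LinearIndependent 𝔽 (fun n : {n : ℤ // 1 ≤ n} => ffst ↑n + ffst (-(↑n : ℤ))) ∧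
    Submodule.span 𝔽 (Set.range (fun n : {n : ℤ // 1 ≤ n} => ffst ↑n + ffst (-(↑n : ℤ)))) =
      invariantsOn 𝔽 (indRep C 𝔽 Wst σst) ↑C.K ∧
    Nonempty (↥(EquivHomSub 𝔽 (indRep C 𝔽 𝔽 (1 : Representation 𝔽 ↥C.K 𝔽))
          (indRep C 𝔽 Wst σst)) ≃ₗ[𝔽]
        ↥(Submodule.span 𝔽
          (Set.range (fun n : {n : ℤ // 1 ≤ n} => ffst ↑n + ffst (-(↑n : ℤ)))))) := by
  obtain ⟨ε, U⟩ := Setting.exists_uniform C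
  obtain ⟨e, he⟩ := exists_frobenius_equiv (ρ := indRep C 𝔽 Wst σst) hfftr.1 (hfftr.zero_apply U)
  have hspan := hffst.span_eq U hst (two_ne_zero_of_algebra (S := S))
  exact ⟨⟨e, he⟩, hffst.linearIndependent U, hspan, ⟨e.trans (LinearEquiv.ofEq _ _ hspan.symm)⟩⟩

end U21
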